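/- Let Δ and Δ′ be integers such that Δ, Δ′, and ΔΔ′ are all non-squares. Define g on squarefree natural numbers by g(n) = ∑_{p ∣ n, p odd prime, p ∤ Δ} ((Δ′/p) − (Δ/p))/2, where (·/p) is the Legendre symbol. Then for every real number r, liminf_{X → ∞} |{n ≤ X : n squarefree and g(n) ≥ r}| / |{n ≤ X : n squarefree}| ≥ 1/2. -/

import Mathlib

namespace LegendreAdditive

open Filter Topology NumberTheorySymbols

/-! ### The quadratic character attached to a nonsquare integer -/

theorem jacobiSym_eq_of_mod_eq {D : ℤ} {m n : ℕ} (hm : Odd m) (hn : Odd n)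
    (h : m % (4 * D.natAbs) = n % (4 * D.natAbs)) : J(D | m) = J(D | n) := by
  rw [jacobiSym.mod_right D hm, jacobiSym.mod_right D hn, h]

theorem mod_four_eq_one {k n : ℕ} (h : n ≡ 1 [MOD 4 * k]) : n % 4 = 1 := by
  have : n ≡ 1 [MOD 4] := h.of_mul_right k
  simpa [Nat.ModEq] using this

theorem jacobiSym_eq_one_of_modEq_one {D : ℤ} {n : ℕ}
    (h : n ≡ 1 [MOD 4 * D.natAbs]) : J(D | n) = 1 := by
  have h4 := mod_four_eq_one h
  rw [jacobiSym_eq_of_mod_eq (Nat.odd_iff.2 (by omega)) odd_one h, jacobiSym.one_right]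

theorem exists_jacobiSym_eq_neg_one_of_prime {D₀ : ℤ} {q e : ℕ} (hq : q.Prime)
    (hqD : ¬ q ∣ D₀.natAbs) :
    ∃ n : ℕ, Odd n ∧ J((q : ℤ) ^ (2 * e + 1) * D₀ | n) = -1 := by
  suffices ∃ n : ℕ, n ≡ 1 [MOD 4 * D₀.natAbs] ∧ J(q | n) = -1 by
    obtain ⟨n, h1, h2⟩ := this
    refine ⟨n, Nat.odd_iff.2 (by have := mod_four_eq_one h1; omega), ?_⟩
    rw [jacobiSym.mul_left, jacobiSym.pow_left, h2, jacobiSym_eq_one_of_modEq_one h1,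
      Odd.neg_one_pow ⟨e, rfl⟩, mul_one]
  rcases hq.eq_two_or_odd' with rfl | hodd
  · refine ⟨4 * D₀.natAbs + 1, by simp [Nat.ModEq], ?_⟩
    have ho : Odd (4 * D₀.natAbs + 1) := ⟨2 * D₀.natAbs, by ring⟩
    have h8 : (4 * D₀.natAbs + 1) % 8 = 5 := by omega
    rw [Nat.cast_ofNat, jacobiSym.at_two ho, ZMod.χ₈_nat_mod_eight, h8]
    decide
  · have : Fact q.Prime := ⟨hq⟩
    obtain ⟨x, hx⟩ := FiniteField.exists_nonsquare (F := ZMod q)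
      (by rw [ZMod.ringChar_zmod_n]; rintro rfl; exact absurd hodd (by decide))
    have hcop : Nat.Coprime (4 * D₀.natAbs) q := by
      refine Nat.Coprime.mul_left ?_ ((Nat.Prime.coprime_iff_not_dvd hq).2 hqD).symm
      exact (Nat.Coprime.pow_left 2 (Nat.coprime_two_left.2 hodd) : Nat.Coprime (2 ^ 2) q)
    obtain ⟨n, h1, h2⟩ := Nat.chineseRemainder hcop 1 x.val
    refine ⟨n, h1, ?_⟩
    rw [jacobiSym.quadratic_reciprocity_one_mod_four' hodd (mod_four_eq_one h1),
      ZMod.nonsquare_iff_jacobiSym_eq_neg_one]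
    have : ((n : ℤ) : ZMod q) = x := by
      rw [Int.cast_natCast, (ZMod.natCast_eq_natCast_iff _ _ _).2 h2, ZMod.natCast_val,
        ZMod.cast_id', id]
    rwa [this]

theorem exists_jacobiSym_eq_neg_one {D : ℤ} (h : ¬ IsSquare D) :
    ∃ n : ℕ, Odd n ∧ J(D | n) = -1 := by
  have hD : D ≠ 0 := by rintro rfl; exact h IsSquare.zero
  have hDn : D.natAbs ≠ 0 := Int.natAbs_ne_zero.2 hD
  obtain ⟨a, b, hab, ha⟩ := Nat.sq_mul_squarefree D.natAbs
  have hb0 : b ≠ 0 := by rintro rfl; simp at hab; omega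
  rcases eq_or_ne a 1 with rfl | ha1
  · have hneg : D = -((b : ℤ) ^ 2) := by
      rcases Int.natAbs_eq D with hp | hp
      · exact absurd ⟨(b : ℤ), by rw [hp, ← hab]; push_cast; ring⟩ h
      · rw [hp, ← hab]; push_cast; ring
    refine ⟨4 * b - 1, Nat.odd_iff.2 (by omega), ?_⟩
    have ho : Odd (4 * b - 1) := Nat.odd_iff.2 (by omega)
    rw [hneg, jacobiSym.neg _ ho, jacobiSym.sq_one', mul_one, ZMod.χ₄_nat_three_mod_four (by omega)]
    rw [Int.gcd_natCast_natCast]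
    have h2 : Nat.gcd b (4 * b - 1) ∣ 1 := by
      have e1 := Nat.gcd_dvd_left b (4 * b - 1)
      have e2 := Nat.gcd_dvd_right b (4 * b - 1)
      have := Nat.dvd_sub (e1.mul_left 4) e2
      rwa [show 4 * b - (4 * b - 1) = 1 by omega] at this
    exact Nat.dvd_one.1 h2
  · obtain ⟨q, hq, a', rfl⟩ := Nat.exists_prime_and_dvd ha1
    obtain ⟨e, b', hb', rfl⟩ := Nat.exists_eq_pow_mul_and_not_dvd hb0 q hq.ne_one
    have hqa : ¬ q ∣ a' := by
      rintro ⟨c, rfl⟩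
      have := ha q ⟨c, by ring⟩
      exact hq.one_lt.ne' (Nat.isUnit_iff.1 this)
    have hprod : D = (q : ℤ) ^ (2 * e + 1) * (D.sign * (b' ^ 2 * a' : ℕ)) := by
      conv_lhs => rw [← Int.sign_mul_natAbs D, ← hab]
      push_cast; ring
    rw [hprod]
    refine exists_jacobiSym_eq_neg_one_of_prime hq ?_
    rw [Int.natAbs_mul, Int.natAbs_sign_of_ne_zero hD, one_mul, Int.natAbs_natCast, hq.dvd_mul]
    exact fun hh => hh.elim (fun h' => hb' (hq.dvd_of_dvd_pow h')) hqa

theorem exists_dirichletCharacter_eq_jacobiSym {D : ℤ} (h : ¬ IsSquare D) :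
    ∃ N : ℕ, ∃ _ : NeZero N, ∃ χ : DirichletCharacter ℂ N, χ ≠ 1 ∧
      ∀ n : ℕ, Odd n → Nat.Coprime n D.natAbs → χ n = (J(D | n) : ℂ) := by
  have hD : D ≠ 0 := by rintro rfl; exact h IsSquare.zero
  have hN : NeZero (4 * D.natAbs) := ⟨by simpa using hD⟩
  have hodd (a : ZMod (4 * D.natAbs)) (ha : IsUnit a) : Odd a.val := by
    have h1 : Nat.Coprime a.val (4 * D.natAbs) :=
      (ZMod.isUnit_iff_coprime _ _).1 (by simpa using ha)
    exact Nat.coprime_two_right.1 (h1.coprime_dvd_right ⟨2 * D.natAbs, by ring⟩)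
  have hval (n : ℕ) (hn : Odd n) (hu : IsUnit (n : ZMod (4 * D.natAbs))) :
      J(D | (n : ZMod (4 * D.natAbs)).val) = J(D | n) :=
    jacobiSym_eq_of_mod_eq (hodd _ hu) hn (by simp [ZMod.val_natCast])
  classical
  let χ : DirichletCharacter ℂ (4 * D.natAbs) :=
    { toFun := fun a => if IsUnit a then (J(D | a.val) : ℂ) else 0
      map_one' := by
        have := hval 1 odd_one (by simp)
        simp only [isUnit_one, if_true]
        rw [Nat.cast_one] at this
        rw [this, jacobiSym.one_right, Int.cast_one]
      map_mul' := fun a b => by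
        by_cases ha : IsUnit a
        · by_cases hb : IsUnit b
          · have hab : IsUnit (a * b) := ha.mul hb
            simp only [ha, hb, hab, if_true]
            have e : ((a.val * b.val : ℕ) : ZMod (4 * D.natAbs)) = a * b := by simp
            have hne (x : ZMod (4 * D.natAbs)) (hx : IsUnit x) : x.val ≠ 0 := (hodd x hx).pos.ne'
            have := hval (a.val * b.val) ((hodd a ha).mul (hodd b hb)) (by rw [e]; exact hab)
            rw [e, jacobiSym.mul_right' D (hne a ha) (hne b hb)] at this
            rw [this]; push_cast; rfl
          · simp [hb]
        · simp [ha]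
      map_nonunit' := fun a ha => by simp [ha] }
  have hχ (n : ℕ) (hn : Odd n) (hc : Nat.Coprime n D.natAbs) : χ n = (J(D | n) : ℂ) := by
    have hu : IsUnit (n : ZMod (4 * D.natAbs)) := by
      rw [ZMod.isUnit_iff_coprime]
      refine Nat.Coprime.mul_right ?_ hc
      exact (Nat.Coprime.pow_right 2 (Nat.coprime_two_right.2 hn) : Nat.Coprime n (2 ^ 2))
    change (if IsUnit (n : ZMod (4 * D.natAbs)) then _ else _) = _
    rw [if_pos hu, hval n hn hu]
  refine ⟨_, hN, χ, ?_, hχ⟩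
  obtain ⟨n, hn, hJ⟩ := exists_jacobiSym_eq_neg_one h
  have hc : Nat.Coprime n D.natAbs := by
    by_contra hc
    have : J(D | n) = 0 := by
      rw [jacobiSym.eq_zero_iff]
      refine ⟨hn.pos.ne', fun hg => hc ?_⟩
      rw [Nat.coprime_comm]
      simpa [Int.gcd] using hg
    omega
  intro h1
  have h2 := hχ n hn hc
  have hu : IsUnit (n : ZMod (4 * D.natAbs)) := by
    rw [ZMod.isUnit_iff_coprime]
    refine Nat.Coprime.mul_right ?_ hc
    exact (Nat.Coprime.pow_right 2 (Nat.coprime_two_right.2 hn) : Nat.Coprime n (2 ^ 2))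
  rw [h1, MulChar.one_apply hu, hJ] at h2
  norm_num at h2

end LegendreAdditive

namespace LegendreAdditive

open Filter Topology

/-! ### Mertens-type estimates -/

theorem sum_log_div_primesLE_le {N : ℕ} (hN : N ≠ 0) :
    ∑ p ∈ Nat.primesLE N, Real.log p / p ≤ Real.log N + Real.log 4 := by
  have hN' : (0 : ℝ) < N := by positivity
  have hdvd : ∏ p ∈ Nat.primesLE N, p ^ (N / p) ∣ N.factorial := by
    refine Finset.prod_dvd_of_isRelPrime ?_ ?_
    · intro p hp q hq hpq
      refine Nat.coprime_iff_isRelPrime.1 (Nat.Coprime.pow _ _ ?_)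
      exact (Nat.coprime_primes (Nat.prime_of_mem_primesLE hp) (Nat.prime_of_mem_primesLE hq)).2 hpq
    · intro p hp
      have hpp := Nat.prime_of_mem_primesLE hp
      rw [hpp.pow_dvd_factorial_iff (b := Nat.log p N + 2) (by omega)]
      simpa using Finset.single_le_sum (f := fun i => N / p ^ i) (fun _ _ => Nat.zero_le _)
        (Finset.mem_Ico.2 ⟨le_rfl, by omega⟩ : 1 ∈ Finset.Ico 1 (Nat.log p N + 2))
  have h1 : ∑ p ∈ Nat.primesLE N, ((N / p : ℕ) : ℝ) * Real.log p ≤ N * Real.log N := by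
    have hle := (Nat.le_of_dvd N.factorial_pos hdvd).trans N.factorial_le_pow
    have hpos : 0 < ∏ p ∈ Nat.primesLE N, p ^ (N / p) :=
      Finset.prod_pos fun p hp => pow_pos (Nat.prime_of_mem_primesLE hp).pos _
    have := Real.log_le_log (by exact_mod_cast hpos)
      (by exact_mod_cast hle : ((∏ p ∈ Nat.primesLE N, p ^ (N / p) : ℕ) : ℝ) ≤ (N : ℝ) ^ N)
    rw [Real.log_pow] at this
    push_cast at this
    rw [Real.log_prod fun p hp =>
      pow_ne_zero _ (Nat.cast_ne_zero.2 (Nat.prime_of_mem_primesLE hp).ne_zero)] at this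
    simpa [Real.log_pow] using this
  have h2 : ∑ p ∈ Nat.primesLE N, Real.log p ≤ Real.log 4 * N := by
    rw [← Chebyshev.theta_eq_sum_primesLE_log]
    exact Chebyshev.theta_le_log4_mul_x hN'.le
  have h3 : N * ∑ p ∈ Nat.primesLE N, Real.log p / p ≤ N * (Real.log N + Real.log 4) := by
    calc N * ∑ p ∈ Nat.primesLE N, Real.log p / p
        = ∑ p ∈ Nat.primesLE N, ((N : ℝ) / p) * Real.log p := by
          rw [Finset.mul_sum]; exact Finset.sum_congr rfl fun p _ => by ring
      _ ≤ ∑ p ∈ Nat.primesLE N, (((N / p : ℕ) : ℝ) * Real.log p + Real.log p) := by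
          refine Finset.sum_le_sum fun p hp => ?_
          have := (Nat.lt_floor_add_one ((N : ℝ) / p)).le
          rw [Nat.floor_div_eq_div] at this
          nlinarith [Real.log_natCast_nonneg p]
      _ ≤ _ := by rw [Finset.sum_add_distrib]; linarith
  exact le_of_mul_le_mul_left h3 hN'

theorem sum_inv_primesLE_sq_sdiff_le {N : ℕ} (hN : 2 ≤ N) :
    ∑ p ∈ Nat.primesLE (N ^ 2) \ Nat.primesLE N, (p : ℝ)⁻¹ ≤ 4 := by
  have hN' : (2 : ℝ) ≤ N := by exact_mod_cast hN
  have hlog : 0 < Real.log N := Real.log_pos (by linarith)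
  have h4 : Real.log 4 ≤ 2 * Real.log N := by
    rw [show (4 : ℝ) = 2 ^ 2 by norm_num, Real.log_pow]
    have := Real.log_le_log two_pos hN'
    push_cast; linarith
  have h := sum_log_div_primesLE_le (N := N ^ 2) (by positivity)
  push_cast at h
  rw [Real.log_pow] at h
  have h1 : Real.log N * ∑ p ∈ Nat.primesLE (N ^ 2) \ Nat.primesLE N, (p : ℝ)⁻¹ ≤
      ∑ p ∈ Nat.primesLE (N ^ 2), Real.log p / p := by
    rw [Finset.mul_sum]
    calc _ ≤ ∑ p ∈ Nat.primesLE (N ^ 2) \ Nat.primesLE N, Real.log p / p := by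
          refine Finset.sum_le_sum fun p hp => ?_
          simp only [Finset.mem_sdiff, Nat.mem_primesLE] at hp
          have : (N : ℝ) ≤ p := by
            have : N ≤ p := by by_contra hh; exact hp.2 ⟨by omega, hp.1.2⟩
            exact_mod_cast this
          rw [div_eq_mul_inv]
          gcongr
      _ ≤ _ := Finset.sum_le_sum_of_subset_of_nonneg Finset.sdiff_subset
          fun p _ _ => div_nonneg (Real.log_natCast_nonneg p) (by positivity)
  push_cast at h
  nlinarith

theorem sum_sdiff_primesLE_pow (a : ℕ → ℝ) {N : ℕ} (hN : 2 ≤ N) (j : ℕ) :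
    ∑ p ∈ Nat.primesLE (N ^ 2 ^ j) \ Nat.primesLE N, a p =
      ∑ i ∈ Finset.range j,
        ∑ p ∈ Nat.primesLE ((N ^ 2 ^ i) ^ 2) \ Nat.primesLE (N ^ 2 ^ i), a p := by
  induction j with
  | zero => simp
  | succ j ih =>
    rw [Finset.sum_range_succ, ← ih, ← pow_mul, ← pow_succ]
    have h1 : Nat.primesLE N ⊆ Nat.primesLE (N ^ 2 ^ j) :=
      Nat.primesLE_mono (Nat.le_self_pow (by positivity) _)
    have h2 : Nat.primesLE (N ^ 2 ^ j) ⊆ Nat.primesLE (N ^ 2 ^ (j + 1)) :=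
      Nat.primesLE_mono (Nat.pow_le_pow_right (by omega) (Nat.pow_le_pow_right two_pos (by omega)))
    have e1 := Finset.sum_sdiff (f := a) h1
    have e2 := Finset.sum_sdiff (f := a) h2
    have e3 := Finset.sum_sdiff (f := a) (h1.trans h2)
    linarith

theorem sum_inv_primesLE_pow_sdiff_le {N : ℕ} (hN : 2 ≤ N) (j : ℕ) :
    ∑ p ∈ Nat.primesLE (N ^ 2 ^ j) \ Nat.primesLE N, (p : ℝ)⁻¹ ≤ 4 * j := by
  rw [sum_sdiff_primesLE_pow (fun p => (p : ℝ)⁻¹) hN]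
  refine (Finset.sum_le_card_nsmul _ _ 4 fun i _ => sum_inv_primesLE_sq_sdiff_le
    (hN.trans (Nat.le_self_pow (by positivity) _))).trans (by simp [mul_comm])

theorem sum_rpow_primesLE_pow_sdiff_le {N : ℕ} (hN : 2 ≤ N) (j : ℕ) :
    ∑ p ∈ Nat.primesLE (N ^ 2 ^ j) \ Nat.primesLE N,
      (p : ℝ) ^ (-(1 + (Real.log N)⁻¹)) ≤ 8 := by
  have hN' : (2 : ℝ) ≤ N := by exact_mod_cast hN
  have hlog : 0 < Real.log N := Real.log_pos (by linarith)
  rw [sum_sdiff_primesLE_pow (fun p => (p : ℝ) ^ (-(1 + (Real.log N)⁻¹))) hN]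
  have key (i : ℕ) : ∑ p ∈ Nat.primesLE ((N ^ 2 ^ i) ^ 2) \ Nat.primesLE (N ^ 2 ^ i),
      (p : ℝ) ^ (-(1 + (Real.log N)⁻¹)) ≤ 4 * (1 / 2) ^ i := by
    have h2 : 2 ≤ N ^ 2 ^ i := hN.trans (Nat.le_self_pow (by positivity) _)
    calc _ ≤ ∑ p ∈ Nat.primesLE ((N ^ 2 ^ i) ^ 2) \ Nat.primesLE (N ^ 2 ^ i),
          (1 / 2 : ℝ) ^ i * (p : ℝ)⁻¹ := by
          refine Finset.sum_le_sum fun p hp => ?_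
          simp only [Finset.mem_sdiff, Nat.mem_primesLE] at hp
          have hle : N ^ 2 ^ i ≤ p := by by_contra hh; exact hp.2 ⟨by omega, hp.1.2⟩
          have hp0 : (0 : ℝ) < p := by exact_mod_cast hp.1.2.pos
          have hle' : (2 : ℝ) ^ i * Real.log N ≤ Real.log p := by
            have : ((N : ℝ)) ^ 2 ^ i ≤ p := by exact_mod_cast hle
            have := Real.log_le_log (by positivity) this
            rw [Real.log_pow] at this
            exact_mod_cast this
          have hi : (i : ℝ) ≤ 2 ^ i := by exact_mod_cast (Nat.lt_two_pow_self (n := i)).le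
          rw [neg_add, Real.rpow_add hp0, Real.rpow_neg_one, mul_comm]
          gcongr
          rw [Real.rpow_def_of_pos hp0, one_div, inv_pow, ← Real.rpow_natCast 2 i,
            Real.rpow_def_of_pos two_pos, ← Real.exp_neg]
          refine Real.exp_le_exp.2 ?_
          have h3 : (2 : ℝ) ^ i ≤ Real.log p * (Real.log N)⁻¹ := by
            rw [← div_eq_mul_inv, le_div_iff₀ hlog]; exact hle'
          have h4 : Real.log 2 ≤ 1 := by linarith [Real.log_two_lt_d9]
          have h5 : Real.log 2 * i ≤ i := by nlinarith [Nat.cast_nonneg (α := ℝ) i]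
          linarith
      _ ≤ _ := by
          rw [← Finset.mul_sum, mul_comm]
          have := sum_inv_primesLE_sq_sdiff_le h2
          gcongr
  calc _ ≤ ∑ i ∈ Finset.range j, 4 * (1 / 2 : ℝ) ^ i := Finset.sum_le_sum fun i _ => key i
    _ = 4 * ∑ i ∈ Finset.range j, (1 / 2 : ℝ) ^ i := by rw [Finset.mul_sum]
    _ ≤ 8 := by
      rw [geom_sum_eq (by norm_num)]
      have : (0 : ℝ) ≤ (1 / 2) ^ j := by positivity
      linarith [show ((1 / 2 : ℝ) ^ j - 1) / (1 / 2 - 1) = 2 - 2 * (1 / 2) ^ j by ring]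

end LegendreAdditive

namespace LegendreAdditive

open Filter Topology

/-! ### Boundedness of prime sums twisted by a nontrivial character -/

theorem norm_neg_log_one_sub_sub_le {z : ℂ} (hz : ‖z‖ ≤ 1 / 2) :
    ‖-Complex.log (1 - z) - z‖ ≤ ‖z‖ ^ 2 := by
  have h := Complex.norm_log_one_add_sub_self_le (z := -z) (by rw [norm_neg]; linarith)
  rw [norm_neg, ← sub_eq_add_neg] at h
  rw [show -Complex.log (1 - z) - z = -(Complex.log (1 - z) - -z) by ring, norm_neg]
  refine h.trans ?_
  have : (1 - ‖z‖)⁻¹ ≤ 2 := by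
    rw [inv_le_comm₀ (by linarith) two_pos]; linarith
  nlinarith [sq_nonneg ‖z‖]

theorem tendsto_sum_primesLE {a : ℕ → ℝ} (h : Summable fun p : Nat.Primes => a p) :
    Tendsto (fun n => ∑ p ∈ Nat.primesLE n, a p) atTop (𝓝 (∑' p : Nat.Primes, a p)) := by
  have h' : Summable ({p : ℕ | p.Prime}.indicator a) := summable_subtype_iff_indicator.1 h
  have h2 := (h'.hasSum.tendsto_sum_nat).comp (tendsto_add_atTop_nat 1)
  have h3 : ∑' p : Nat.Primes, a p = ∑' n, {p : ℕ | p.Prime}.indicator a n :=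
    tsum_subtype {p : ℕ | p.Prime} a
  rw [h3]
  refine h2.congr fun n => ?_
  rw [Nat.primesLE_eq_filter_range, Finset.sum_filter]
  exact Finset.sum_congr rfl fun p _ => by simp [Set.indicator_apply]

theorem exists_forall_abs_tsum_primes_le {N : ℕ} [NeZero N] {χ : DirichletCharacter ℂ N}
    (hχ : χ ≠ 1) :
    ∃ C : ℝ, ∀ s : ℝ, 1 < s → s ≤ 3 → |∑' p : Nat.Primes, (χ p).re * (p : ℝ) ^ (-s)| ≤ C := by
  obtain ⟨B, hB⟩ : ∃ B, ∀ s ∈ Set.Icc (1 : ℝ) 3,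
      ‖Real.log ‖DirichletCharacter.LFunction χ (s : ℂ)‖‖ ≤ B := by
    refine isCompact_Icc.exists_bound_of_continuousOn ?_
    refine ContinuousOn.log ?_ fun s hs => ?_
    · exact (((DirichletCharacter.differentiable_LFunction hχ).continuous.comp
        Complex.continuous_ofReal).norm).continuousOn
    · exact norm_ne_zero_iff.2
        (DirichletCharacter.LFunction_ne_zero_of_one_le_re χ (.inl hχ) (by simpa using hs.1))
  have hsum2 : Summable fun p : Nat.Primes => (p : ℝ) ^ (-2 : ℝ) :=
    Nat.Primes.summable_rpow.2 (by norm_num)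
  refine ⟨B + ∑' p : Nat.Primes, (p : ℝ) ^ (-2 : ℝ), fun s hs hs3 => ?_⟩
  set z : Nat.Primes → ℂ := fun p => χ p * (p : ℂ) ^ (-(s : ℂ)) with hz
  have hnorm (p : Nat.Primes) : ‖z p‖ ≤ (p : ℝ) ^ (-s) := by
    simp only [hz, norm_mul]
    rw [Complex.norm_natCast_cpow_of_pos p.2.pos, Complex.neg_re, Complex.ofReal_re]
    exact mul_le_of_le_one_left (by positivity) (χ.norm_le_one _)
  have hp1 (p : Nat.Primes) : (p : ℝ) ^ (-s) ≤ (p : ℝ) ^ (-1 : ℝ) :=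
    Real.rpow_le_rpow_of_exponent_le (by exact_mod_cast p.2.one_le) (by linarith)
  have hhalf (p : Nat.Primes) : ‖z p‖ ≤ 1 / 2 := by
    refine (hnorm p).trans ((hp1 p).trans ?_)
    rw [Real.rpow_neg_one, one_div]
    exact inv_anti₀ two_pos (by exact_mod_cast p.2.two_le)
  have hsq (p : Nat.Primes) : ‖z p‖ ^ 2 ≤ (p : ℝ) ^ (-2 : ℝ) := by
    calc ‖z p‖ ^ 2 ≤ ((p : ℝ) ^ (-1 : ℝ)) ^ 2 :=
          pow_le_pow_left₀ (norm_nonneg _) ((hnorm p).trans (hp1 p)) 2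
      _ = _ := by rw [← Real.rpow_natCast, ← Real.rpow_mul (by positivity)]; norm_num
  have hzs : Summable z := .of_norm_bounded (Nat.Primes.summable_rpow.2 (by linarith)) hnorm
  have hdn (p : Nat.Primes) : ‖-Complex.log (1 - z p) - z p‖ ≤ (p : ℝ) ^ (-2 : ℝ) :=
    (norm_neg_log_one_sub_sub_le (hhalf p)).trans (hsq p)
  have hds : Summable fun p => -Complex.log (1 - z p) - z p := .of_norm_bounded hsum2 hdn
  have hL := DirichletCharacter.LSeries_eulerProduct_exp_log χ (s := s) (by simpa using hs)
  rw [← DirichletCharacter.LFunction_eq_LSeries χ (by simpa using hs)] at hL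
  have hsplit : ∑' p : Nat.Primes, -Complex.log (1 - z p) =
      (∑' p, (-Complex.log (1 - z p) - z p)) + ∑' p, z p := by
    rw [← hds.tsum_add hzs]; simp
  have hre : (∑' p, z p).re = ∑' p : Nat.Primes, (χ p).re * (p : ℝ) ^ (-s) := by
    rw [Complex.re_tsum hzs]
    refine tsum_congr fun p => ?_
    simp only [hz]
    rw [show (p : ℂ) ^ (-(s : ℂ)) = (((p : ℝ) ^ (-s) : ℝ) : ℂ) by
      rw [Complex.ofReal_cpow (by positivity)]; simp, Complex.re_mul_ofReal]
  have hlog : (∑' p : Nat.Primes, -Complex.log (1 - z p)).re =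
      Real.log ‖DirichletCharacter.LFunction χ (s : ℂ)‖ := by
    rw [← hL, Complex.norm_exp, Real.log_exp]
  rw [hsplit, Complex.add_re, hre] at hlog
  have h1 := hB s ⟨hs.le, hs3⟩
  rw [Real.norm_eq_abs, ← hlog] at h1
  have h2 : |(∑' p, (-Complex.log (1 - z p) - z p)).re| ≤ ∑' p : Nat.Primes, (p : ℝ) ^ (-2 : ℝ) :=
    (Complex.abs_re_le_norm _).trans (tsum_of_norm_bounded hsum2.hasSum hdn)
  rw [abs_le] at *
  constructor <;> linarith

theorem exists_forall_abs_sum_char_div_le {N : ℕ} [NeZero N] {χ : DirichletCharacter ℂ N}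
    (hχ : χ ≠ 1) :
    ∃ C : ℝ, ∀ x : ℕ, |∑ p ∈ Nat.primesLE x, (χ p).re / p| ≤ C := by
  obtain ⟨C, hC⟩ := exists_forall_abs_tsum_primes_le hχ
  have hχre (p : ℕ) : |(χ p).re| ≤ 1 := (Complex.abs_re_le_norm _).trans (χ.norm_le_one _)
  have hC0 : 0 ≤ C := (abs_nonneg _).trans (hC 2 (by norm_num) (by norm_num))
  refine ⟨C + 11, fun x => ?_⟩
  rcases lt_or_ge x 2 with hx | hx
  · have : Nat.primesLE x = ∅ := by
      ext p
      simp only [Nat.mem_primesLE, Finset.notMem_empty, iff_false, not_and]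
      exact fun h hp => by have := hp.two_le; omega
    rw [this]; simp; linarith
  have hx' : (2 : ℝ) ≤ x := by exact_mod_cast hx
  have hlog2 : Real.log 2 ≤ Real.log x := Real.log_le_log two_pos hx'
  have hl2 : 0.6931471803 < Real.log 2 := Real.log_two_gt_d9
  have hlog : 0 < Real.log x := by linarith
  set δ := (Real.log x)⁻¹ with hδ
  have hδ0 : 0 < δ := inv_pos.2 hlog
  have hδ2 : δ ≤ 2 := by
    rw [hδ, inv_le_comm₀ hlog two_pos]; linarith
  have hT := hC (1 + δ) (by linarith) (by linarith)
  set a : ℕ → ℝ := fun p => (χ p).re * (p : ℝ) ^ (-(1 + δ)) with ha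
  have han (p : ℕ) : |a p| ≤ (p : ℝ) ^ (-(1 + δ)) := by
    simp only [ha, abs_mul]
    rw [abs_of_nonneg (by positivity : (0 : ℝ) ≤ (p : ℝ) ^ (-(1 + δ)))]
    exact mul_le_of_le_one_left (by positivity) (hχre p)
  have has : Summable fun p : Nat.Primes => a p :=
    .of_norm_bounded (Nat.Primes.summable_rpow.2 (by linarith)) fun p => han p
  have hpow : Tendsto (fun j : ℕ => x ^ 2 ^ j) atTop atTop :=
    (tendsto_pow_atTop_atTop_of_one_lt (by omega)).comp
      (tendsto_pow_atTop_atTop_of_one_lt (by norm_num))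
  have htail : |(∑' p : Nat.Primes, a p) - ∑ p ∈ Nat.primesLE x, a p| ≤ 8 := by
    have hl := (((tendsto_sum_primesLE has).comp hpow).sub_const
      (∑ p ∈ Nat.primesLE x, a p)).abs
    refine le_of_tendsto hl (Eventually.of_forall fun j => ?_)
    have hsub : Nat.primesLE x ⊆ Nat.primesLE (x ^ 2 ^ j) :=
      Nat.primesLE_mono (Nat.le_self_pow (by positivity) _)
    rw [Function.comp_apply, ← Finset.sum_sdiff hsub, add_sub_cancel_right]
    exact (Finset.abs_sum_le_sum_abs _ _).trans ((Finset.sum_le_sum fun p _ => han p).trans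
      (sum_rpow_primesLE_pow_sdiff_le hx j))
  have hshift : |∑ p ∈ Nat.primesLE x, (χ p).re / p - ∑ p ∈ Nat.primesLE x, a p| ≤ 3 := by
    rw [← Finset.sum_sub_distrib]
    calc _ ≤ ∑ p ∈ Nat.primesLE x, |(χ p).re / p - a p| := Finset.abs_sum_le_sum_abs _ _
      _ ≤ ∑ p ∈ Nat.primesLE x, δ * (Real.log p / p) := by
        refine Finset.sum_le_sum fun p hp => ?_
        have hp0 : (0 : ℝ) < p := by exact_mod_cast (Nat.prime_of_mem_primesLE hp).pos
        have e : (χ p).re / p - a p = (χ p).re * ((1 - (p : ℝ) ^ (-δ)) / p) := by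
          simp only [ha, neg_add, Real.rpow_add hp0, Real.rpow_neg_one]
          ring
        have h1 : (p : ℝ) ^ (-δ) ≤ 1 := by
          refine Real.rpow_le_one_of_one_le_of_nonpos ?_ (by linarith)
          exact_mod_cast (Nat.prime_of_mem_primesLE hp).one_le
        have h2 : 1 - (p : ℝ) ^ (-δ) ≤ δ * Real.log p := by
          rw [Real.rpow_def_of_pos hp0]
          have := Real.add_one_le_exp (Real.log p * -δ)
          linarith
        rw [e, abs_mul, abs_of_nonneg (div_nonneg (by linarith) hp0.le)]
        calc _ ≤ (1 - (p : ℝ) ^ (-δ)) / p :=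
              mul_le_of_le_one_left (div_nonneg (by linarith) hp0.le) (hχre p)
          _ ≤ δ * Real.log p / p := by gcongr
          _ = _ := by ring
      _ ≤ δ * (Real.log x + Real.log 4) := by
        rw [← Finset.mul_sum]
        exact mul_le_mul_of_nonneg_left (sum_log_div_primesLE_le (by omega)) hδ0.le
      _ ≤ δ * (3 * Real.log x) := by
        have h4 : Real.log 4 = 2 * Real.log 2 := by
          rw [show (4 : ℝ) = 2 ^ 2 by norm_num, Real.log_pow]; norm_num
        refine mul_le_mul_of_nonneg_left (by linarith) hδ0.le
      _ = 3 := by rw [hδ]; field_simp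
  rw [abs_le] at *
  constructor <;> linarith

end LegendreAdditive

namespace LegendreAdditive

open Filter Topology NumberTheorySymbols

/-! ### The summand attached to two nonsquare integers -/

theorem exists_forall_abs_sum_div_sub_le (a b : ℕ → ℝ) {M : ℕ} (hM : M ≠ 0)
    (hab : ∀ p : ℕ, p.Prime → ¬ p ∣ M → a p = b p) :
    ∃ K : ℝ, ∀ x : ℕ,
      |∑ p ∈ Nat.primesLE x, a p / p - ∑ p ∈ Nat.primesLE x, b p / p| ≤ K := by
  refine ⟨∑ p ∈ M.primeFactors, |a p / p - b p / p|, fun x => ?_⟩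
  rw [← Finset.sum_sub_distrib]
  refine (Finset.abs_sum_le_sum_abs _ _).trans ?_
  rw [← Finset.sum_filter_add_sum_filter_not _ (fun p => p ∣ M)]
  have h0 : ∑ p ∈ Nat.primesLE x with ¬ p ∣ M, |a p / p - b p / p| = 0 := by
    refine Finset.sum_eq_zero fun p hp => ?_
    rw [Finset.mem_filter] at hp
    rw [hab p (Nat.prime_of_mem_primesLE hp.1) hp.2, sub_self, abs_zero]
  rw [h0, add_zero]
  refine Finset.sum_le_sum_of_subset_of_nonneg (fun p hp => ?_) fun _ _ _ => abs_nonneg _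
  rw [Finset.mem_filter] at hp
  exact Nat.mem_primeFactors.2 ⟨Nat.prime_of_mem_primesLE hp.1, hp.2, hM⟩

theorem exists_forall_abs_sum_jacobiSym_div_le {D : ℤ} (h : ¬ IsSquare D) :
    ∃ C : ℝ, ∀ x : ℕ, |∑ p ∈ Nat.primesLE x, (J(D | p) : ℝ) / p| ≤ C := by
  have hD : D ≠ 0 := by rintro rfl; exact h IsSquare.zero
  obtain ⟨N, _, χ, hχ, hJ⟩ := exists_dirichletCharacter_eq_jacobiSym h
  obtain ⟨C, hC⟩ := exists_forall_abs_sum_char_div_le hχ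
  obtain ⟨K, hK⟩ := exists_forall_abs_sum_div_sub_le (fun p => (J(D | p) : ℝ))
    (fun p => (χ p).re) (M := 2 * D.natAbs) (by simpa using hD) (fun p hp hpM => by
      have h2 : ¬ p ∣ 2 := fun h2 => hpM (h2.mul_right _)
      have hodd : Odd p := hp.odd_of_ne_two (by rintro rfl; exact h2 dvd_rfl)
      have hc : Nat.Coprime p D.natAbs :=
        (Nat.Prime.coprime_iff_not_dvd hp).2 fun h' => hpM (h'.mul_left _)
      simp [hJ p hodd hc])
  refine ⟨K + C, fun x => ?_⟩
  have h1 := hC x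
  have h2 := hK x
  rw [abs_le] at *
  constructor <;> linarith

theorem tendsto_sum_inv_primesLE :
    Tendsto (fun N => ∑ p ∈ Nat.primesLE N, (p : ℝ)⁻¹) atTop atTop := by
  have h := (not_summable_iff_tendsto_nat_atTop_of_nonneg
    (fun n => Set.indicator_nonneg (fun p _ => by positivity) n)).1 not_summable_one_div_on_primes
  refine (h.comp (tendsto_add_atTop_nat 1)).congr fun n => ?_
  rw [Nat.primesLE_eq_filter_range, Finset.sum_filter]
  exact Finset.sum_congr rfl fun p _ => by simp [Set.indicator_apply]

/-- Half the difference of the Jacobi symbols of `Δ'` and `Δ`, at odd `p` not dividing `Δ`. -/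
noncomputable def halfDiff (Δ Δ' : ℤ) (p : ℕ) : ℝ :=
  open Classical in
  if Odd p ∧ ¬ (p : ℤ) ∣ Δ then ((J(Δ' | p) : ℝ) - J(Δ | p)) / 2 else 0

theorem abs_jacobiSym_le_one (D : ℤ) (n : ℕ) : |(J(D | n) : ℝ)| ≤ 1 := by
  rcases jacobiSym.trichotomy D n with h | h | h <;> simp [h]

theorem abs_halfDiff_le_one (Δ Δ' : ℤ) (p : ℕ) : |halfDiff Δ Δ' p| ≤ 1 := by
  unfold halfDiff
  split_ifs
  · have h1 := abs_jacobiSym_le_one Δ' p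
    have h2 := abs_jacobiSym_le_one Δ p
    rw [abs_le] at *
    constructor <;> linarith
  · simp

theorem halfDiff_eq_of_not_dvd {Δ Δ' : ℤ} {p : ℕ} (hp : p.Prime) (h : ¬ p ∣ 2 * Δ.natAbs) :
    halfDiff Δ Δ' p = ((J(Δ' | p) : ℝ) - J(Δ | p)) / 2 := by
  have h2 : ¬ p ∣ 2 := fun h2 => h (h2.mul_right _)
  have hodd : Odd p := hp.odd_of_ne_two (by rintro rfl; exact h2 dvd_rfl)
  rw [halfDiff, if_pos ⟨hodd, fun hd => h ((Int.natCast_dvd.1 hd).mul_left _)⟩]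

theorem exists_forall_abs_sum_halfDiff_div_le {Δ Δ' : ℤ} (h1 : ¬ IsSquare Δ)
    (h2 : ¬ IsSquare Δ') :
    ∃ C : ℝ, ∀ x : ℕ, |∑ p ∈ Nat.primesLE x, halfDiff Δ Δ' p / p| ≤ C := by
  have hD : Δ ≠ 0 := by rintro rfl; exact h1 IsSquare.zero
  obtain ⟨C, hC⟩ := exists_forall_abs_sum_jacobiSym_div_le h1
  obtain ⟨C', hC'⟩ := exists_forall_abs_sum_jacobiSym_div_le h2
  obtain ⟨K, hK⟩ := exists_forall_abs_sum_div_sub_le (halfDiff Δ Δ')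
    (fun p => ((J(Δ' | p) : ℝ) - J(Δ | p)) / 2) (M := 2 * Δ.natAbs) (by simpa using hD)
    (fun p hp hpM => halfDiff_eq_of_not_dvd hp hpM)
  refine ⟨K + (C + C') / 2, fun x => ?_⟩
  have e : ∑ p ∈ Nat.primesLE x, ((J(Δ' | p) : ℝ) - J(Δ | p)) / 2 / p =
      (∑ p ∈ Nat.primesLE x, (J(Δ' | p) : ℝ) / p -
        ∑ p ∈ Nat.primesLE x, (J(Δ | p) : ℝ) / p) / 2 := by
    rw [← Finset.sum_sub_distrib, Finset.sum_div]
    exact Finset.sum_congr rfl fun p _ => by ring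
  have h3 := hC x
  have h4 := hC' x
  have h5 := hK x
  rw [e] at h5
  rw [abs_le] at *
  constructor <;> linarith

theorem tendsto_sum_halfDiff_sq_div {Δ Δ' : ℤ} (h1 : ¬ IsSquare Δ) (h2 : ¬ IsSquare Δ')
    (h3 : ¬ IsSquare (Δ * Δ')) :
    Tendsto (fun N => ∑ p ∈ Nat.primesLE N, halfDiff Δ Δ' p ^ 2 / p) atTop atTop := by
  have hD : Δ ≠ 0 := by rintro rfl; exact h1 IsSquare.zero
  have hD' : Δ' ≠ 0 := by rintro rfl; exact h2 IsSquare.zero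
  obtain ⟨C, hC⟩ := exists_forall_abs_sum_jacobiSym_div_le h3
  obtain ⟨K, hK⟩ := exists_forall_abs_sum_div_sub_le (fun p => halfDiff Δ Δ' p ^ 2)
    (fun p => (1 - (J(Δ * Δ' | p) : ℝ)) / 2) (M := 2 * Δ.natAbs * Δ'.natAbs)
    (by simpa using ⟨hD, hD'⟩) (fun p hp hpM => by
      have hn : ¬ p ∣ 2 * Δ.natAbs := fun h => hpM (h.mul_right _)
      have hn' : ¬ p ∣ Δ'.natAbs := fun h => hpM (h.mul_left _)
      have hn'' : ¬ p ∣ Δ.natAbs := fun h => hn (h.mul_left _)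
      have hsq {E : ℤ} (hE : ¬ p ∣ E.natAbs) : (J(E | p) : ℝ) ^ 2 = 1 := by
        have : E.gcd p = 1 := by
          have := ((Nat.Prime.coprime_iff_not_dvd hp).2 hE).symm
          simpa [Int.gcd] using this
        exact_mod_cast jacobiSym.sq_one this
      rw [halfDiff_eq_of_not_dvd hp hn, jacobiSym.mul_left]
      push_cast
      have e1 := hsq hn'
      have e2 := hsq hn''
      linear_combination e1 / 4 + e2 / 4)
  have hlim : Tendsto (fun N => (1 / 2 : ℝ) * ∑ p ∈ Nat.primesLE N, (p : ℝ)⁻¹ + -(C / 2 + K))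
      atTop atTop :=
    tendsto_atTop_add_const_right _ _ (tendsto_sum_inv_primesLE.const_mul_atTop (by norm_num))
  refine tendsto_atTop_mono (fun N => ?_) hlim
  have e : ∑ p ∈ Nat.primesLE N, (1 - (J(Δ * Δ' | p) : ℝ)) / 2 / p =
      1 / 2 * ∑ p ∈ Nat.primesLE N, (p : ℝ)⁻¹ -
        1 / 2 * ∑ p ∈ Nat.primesLE N, (J(Δ * Δ' | p) : ℝ) / p := by
    rw [← mul_sub, ← Finset.sum_sub_distrib, Finset.mul_sum]
    exact Finset.sum_congr rfl fun p _ => by ring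
  have h4 := abs_le.1 (hC N)
  have h5 := abs_le.1 (hK N)
  rw [e] at h5
  linarith

end LegendreAdditive

namespace LegendreAdditive

open Filter Topology

/-! ### Averages over initial segments -/

/-- The average of `F` over `1, …, N`. -/
def mean {K : Type*} [Field K] (N : ℕ) (F : ℕ → K) : K := (∑ m ∈ Finset.Ioc 0 N, F m) / N

section mean

variable {K : Type*} [Field K]

theorem mean_add (N : ℕ) (F G : ℕ → K) :
    mean N (fun m => F m + G m) = mean N F + mean N G := by
  simp [mean, Finset.sum_add_distrib, add_div]

theorem mean_sub (N : ℕ) (F G : ℕ → K) :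
    mean N (fun m => F m - G m) = mean N F - mean N G := by
  simp [mean, Finset.sum_sub_distrib, sub_div]

theorem mean_const_mul (N : ℕ) (c : K) (F : ℕ → K) :
    mean N (fun m => c * F m) = c * mean N F := by
  simp [mean, ← Finset.mul_sum, mul_div_assoc]

theorem mean_sum {ι : Type*} (s : Finset ι) (N : ℕ) (F : ι → ℕ → K) :
    mean N (fun m => ∑ i ∈ s, F i m) = ∑ i ∈ s, mean N (F i) := by
  simp only [mean]
  rw [Finset.sum_comm, Finset.sum_div]

theorem mean_dvd [CharZero K] (N D : ℕ) :
    mean N (fun m => if D ∣ m then (1 : K) else 0) = (N / D : ℕ) / N := by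
  simp only [mean, Finset.sum_boole, Nat.Ioc_filter_dvd_card_eq_div]

theorem mean_dvd_of_dvd [CharZero K] {M D : ℕ} (hM : M ≠ 0) (h : D ∣ M) :
    mean M (fun m => if D ∣ m then (1 : K) else 0) = (D : K)⁻¹ := by
  have hD : (D : K) ≠ 0 := Nat.cast_ne_zero.2 (ne_zero_of_dvd_ne_zero hM h)
  have hM' : (M : K) ≠ 0 := Nat.cast_ne_zero.2 hM
  rw [mean_dvd, Nat.cast_div h hD]
  field_simp

end mean

theorem mean_mono {N : ℕ} {F G : ℕ → ℝ} (h : ∀ m ∈ Finset.Ioc 0 N, F m ≤ G m) :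
    mean N F ≤ mean N G :=
  div_le_div_of_nonneg_right (Finset.sum_le_sum h) (Nat.cast_nonneg N)

theorem norm_mean_le {N : ℕ} {F : ℕ → ℂ} {G : ℕ → ℝ} (h : ∀ m ∈ Finset.Ioc 0 N, ‖F m‖ ≤ G m) :
    ‖mean N F‖ ≤ mean N G := by
  rw [mean, mean, norm_div, Complex.norm_natCast]
  exact div_le_div_of_nonneg_right (norm_sum_le_of_le _ h) (Nat.cast_nonneg N)

theorem ofReal_mean (N : ℕ) (F : ℕ → ℝ) : ((mean N F : ℝ) : ℂ) = mean N fun m => (F m : ℂ) := by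
  simp [mean]

theorem mean_dvd_le (N : ℕ) {D : ℕ} :
    mean N (fun m => if D ∣ m then (1 : ℝ) else 0) ≤ (D : ℝ)⁻¹ := by
  rcases Nat.eq_zero_or_pos N with rfl | hN
  · simp [mean]
  have hN' : (0 : ℝ) < N := by exact_mod_cast hN
  rw [mean_dvd, div_le_iff₀ hN']
  exact Nat.cast_div_le.trans (by rw [mul_comm, div_eq_mul_inv])

theorem abs_mean_dvd_sub_inv_le {N : ℕ} (hN : 0 < N) (D : ℕ) :
    |mean N (fun m => if D ∣ m then (1 : ℝ) else 0) - (D : ℝ)⁻¹| ≤ (N : ℝ)⁻¹ := by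
  have hN' : (0 : ℝ) < N := by exact_mod_cast hN
  rw [abs_sub_comm, abs_of_nonneg (sub_nonneg.2 (mean_dvd_le N)), mean_dvd,
    ← Nat.floor_div_eq_div (K := ℝ)]
  have h := (Nat.lt_floor_add_one ((N : ℝ) / D)).le
  rw [sub_le_iff_le_add, ← mul_le_mul_iff_of_pos_left hN']
  calc (N : ℝ) * (D : ℝ)⁻¹ = N / D := by rw [div_eq_mul_inv]
    _ ≤ _ := h
    _ = _ := by field_simp; ring

theorem prod_primes_dvd_iff {T : Finset ℕ} (hT : ∀ p ∈ T, p.Prime) (m : ℕ) :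
    ∏ p ∈ T, p ∣ m ↔ ∀ p ∈ T, p ∣ m := by
  refine ⟨fun h p hp => (Finset.dvd_prod_of_mem _ hp).trans h, fun h => ?_⟩
  exact Finset.prod_primes_dvd m (fun p hp => (hT p hp).prime) h

theorem mean_prod_ite_dvd {K : Type*} [Field K] [CharZero K] {P : Finset ℕ}
    (hP : ∀ p ∈ P, p.Prime) (a : ℕ → K) :
    mean (∏ p ∈ P, p) (fun m => ∏ p ∈ P, if p ∣ m then a p else 1) =
      ∏ p ∈ P, (1 + (a p - 1) / p) := by
  have hM : ∏ p ∈ P, p ≠ 0 := Finset.prod_ne_zero_iff.2 fun p hp => (hP p hp).ne_zero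
  have e (m : ℕ) : (∏ p ∈ P, if p ∣ m then a p else 1) =
      ∑ T ∈ P.powerset, (∏ p ∈ T, (a p - 1)) * if ∏ p ∈ T, p ∣ m then (1 : K) else 0 := by
    rw [Finset.prod_congr rfl (fun p _ => show (if p ∣ m then a p else 1) =
      1 + (a p - 1) * (if p ∣ m then 1 else 0) by split_ifs <;> ring), Finset.prod_one_add]
    refine Finset.sum_congr rfl fun T hT => ?_
    rw [Finset.prod_mul_distrib, Finset.prod_boole]
    simp only [prod_primes_dvd_iff fun p hp => hP p (Finset.mem_powerset.1 hT hp)]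
  simp only [e]
  rw [mean_sum, Finset.prod_one_add]
  refine Finset.sum_congr rfl fun T hT => ?_
  rw [mean_const_mul, mean_dvd_of_dvd hM
    (Finset.prod_dvd_prod_of_subset _ _ _ (Finset.mem_powerset.1 hT)), Finset.prod_div_distrib,
    div_eq_mul_inv, Nat.cast_prod]

/-- The sum of `f` over the primes up to `y` dividing `m`. -/
def primeSum (f : ℕ → ℝ) (y m : ℕ) : ℝ := ∑ p ∈ Nat.primesLE y, if p ∣ m then f p else 0

theorem abs_mean_primeSum_pow_sub_le {f : ℕ → ℝ} (hf : ∀ p, |f p| ≤ 1) {N : ℕ} (hN : 0 < N)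
    (y k : ℕ) :
    |mean N (fun m => primeSum f y m ^ k) -
      mean (∏ p ∈ Nat.primesLE y, p) (fun m => primeSum f y m ^ k)| ≤ (y : ℝ) ^ k / N := by
  have hP : ∀ p ∈ Nat.primesLE y, p.Prime := fun p hp => Nat.prime_of_mem_primesLE hp
  have hM : ∏ p ∈ Nat.primesLE y, p ≠ 0 := Finset.prod_ne_zero_iff.2 fun p hp => (hP p hp).ne_zero
  set V := Fintype.piFinset (fun _ : Fin k => Nat.primesLE y) with hV
  have himg (v : Fin k → ℕ) (hv : v ∈ V) : Finset.univ.image v ⊆ Nat.primesLE y := by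
    intro p hp
    obtain ⟨i, _, rfl⟩ := Finset.mem_image.1 hp
    exact Fintype.mem_piFinset.1 hv i
  have e (m : ℕ) : primeSum f y m ^ k = ∑ v ∈ V, (∏ i, f (v i)) *
      if ∏ p ∈ Finset.univ.image v, p ∣ m then (1 : ℝ) else 0 := by
    rw [primeSum, ← Fin.prod_const, Finset.prod_univ_sum]
    refine Finset.sum_congr rfl fun v hv => ?_
    rw [Finset.prod_congr rfl (fun i _ => show (if v i ∣ m then f (v i) else 0) =
      f (v i) * (if v i ∣ m then 1 else 0) by split_ifs <;> ring), Finset.prod_mul_distrib,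
      Finset.prod_boole]
    simp only [prod_primes_dvd_iff fun p hp => hP p (himg v hv hp), Finset.mem_image,
      Finset.mem_univ, true_and, forall_exists_index, forall_apply_eq_imp_iff, forall_const]
  simp only [e]
  rw [mean_sum, mean_sum, ← Finset.sum_sub_distrib]
  calc _ ≤ ∑ v ∈ V, (N : ℝ)⁻¹ := by
        refine (Finset.abs_sum_le_sum_abs _ _).trans (Finset.sum_le_sum fun v hv => ?_)
        rw [mean_const_mul, mean_const_mul, ← mul_sub, mean_dvd_of_dvd hM
          (Finset.prod_dvd_prod_of_subset _ _ _ (himg v hv)), abs_mul, Finset.abs_prod]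
        exact (mul_le_of_le_one_left (abs_nonneg _)
          (Finset.prod_le_one (fun _ _ => abs_nonneg _) fun i _ => hf _)).trans
          (abs_mean_dvd_sub_inv_le hN _)
    _ = (Nat.primesLE y).card ^ k / N := by
        rw [Finset.sum_const, hV, Fintype.card_piFinset]; simp [div_eq_mul_inv]
    _ ≤ _ := by
        gcongr
        rw [Nat.primesLE_eq_filter_Ioc_zero]
        exact (Finset.card_filter_le _ _).trans (by simp)

end LegendreAdditive

namespace LegendreAdditive

open Filter Topology

/-! ### Exponential estimates -/

theorem norm_exp_mul_sub_sum_le {θ : ℂ} (hθ : θ.re = 0) (hθ1 : ‖θ‖ = 1) (n : ℕ) :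
    ∀ x : ℝ, 0 ≤ x →
      ‖Complex.exp (x * θ) - ∑ j ∈ Finset.range n, (x * θ) ^ j / (j.factorial : ℂ)‖ ≤
        x ^ n / n.factorial := by
  induction n with
  | zero => intro x _; simp [Complex.norm_exp, hθ]
  | succ n ih =>
    intro x hx
    have hd (j : ℕ) (x : ℝ) : HasDerivAt
        (fun x : ℝ => ((x : ℂ) * θ) ^ (j + 1) / ((j + 1).factorial : ℂ))
        (θ * (((x : ℂ) * θ) ^ j / (j.factorial : ℂ))) x := by
      have h1 : HasDerivAt (fun x : ℝ => (x : ℂ) * θ) θ x := by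
        simpa using (Complex.ofRealCLM.hasDerivAt (x := x)).mul_const θ
      refine ((h1.pow (j + 1)).div_const _).congr_deriv ?_
      rw [Nat.factorial_succ]
      have : (j.factorial : ℂ) ≠ 0 := Nat.cast_ne_zero.2 j.factorial_ne_zero
      have : (j + 1 : ℂ) ≠ 0 := by exact_mod_cast j.succ_ne_zero
      push_cast
      field_simp
    have hf (x : ℝ) : HasDerivAt (fun x : ℝ => Complex.exp (x * θ) -
        ∑ j ∈ Finset.range (n + 1), ((x : ℂ) * θ) ^ j / (j.factorial : ℂ))
        (θ * (Complex.exp (x * θ) -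
          ∑ j ∈ Finset.range n, ((x : ℂ) * θ) ^ j / (j.factorial : ℂ))) x := by
      simp only [Finset.sum_range_succ' _ n, pow_zero]
      have h1 : HasDerivAt (fun x : ℝ => (x : ℂ) * θ) θ x := by
        simpa using (Complex.ofRealCLM.hasDerivAt (x := x)).mul_const θ
      refine (h1.cexp.sub ((HasDerivAt.fun_sum fun j _ => hd j x).add_const _)).congr_deriv ?_
      rw [mul_sub, Finset.mul_sum]; ring
    have hB (x : ℝ) : HasDerivAt (fun x : ℝ => x ^ (n + 1) / ((n + 1).factorial : ℝ))
        (x ^ n / n.factorial) x := by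
      refine ((hasDerivAt_pow (n + 1) x).div_const _).congr_deriv ?_
      rw [Nat.factorial_succ]
      push_cast
      field_simp
    refine image_norm_le_of_norm_deriv_right_le_deriv_boundary (a := 0) (b := x)
      (fun x _ => (hf x).continuousAt.continuousWithinAt)
      (fun x _ => (hf x).hasDerivWithinAt) ?_ hB (fun x hx => ?_) ⟨hx, le_rfl⟩
    · simp [Finset.sum_range_succ']
    · rw [norm_mul, hθ1, one_mul]
      exact ih x hx.1

theorem norm_exp_mul_I_sub_sum_le (x : ℝ) (n : ℕ) :
    ‖Complex.exp (x * Complex.I) -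
      ∑ j ∈ Finset.range n, (x * Complex.I) ^ j / (j.factorial : ℂ)‖ ≤ |x| ^ n / n.factorial := by
  rcases le_total 0 x with hx | hx
  · rw [abs_of_nonneg hx]
    exact norm_exp_mul_sub_sum_le (by simp) (by simp) n x hx
  · rw [abs_of_nonpos hx]
    have := norm_exp_mul_sub_sum_le (θ := -Complex.I) (by simp) (by simp) n (-x) (by linarith)
    simpa using this

theorem norm_exp_mul_I_sub_one_le (x : ℝ) : ‖Complex.exp (x * Complex.I) - 1‖ ≤ |x| := by
  simpa using norm_exp_mul_I_sub_sum_le x 1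

theorem norm_exp_mul_I_sub_quadratic_le (x : ℝ) :
    ‖Complex.exp (x * Complex.I) - 1 - x * Complex.I + x ^ 2 / 2‖ ≤ |x| ^ 3 := by
  have h := norm_exp_mul_I_sub_sum_le x 3
  simp only [Finset.sum_range_succ, Finset.sum_range_zero, Nat.factorial] at h
  have e : Complex.exp (x * Complex.I) - 1 - x * Complex.I + x ^ 2 / 2 =
      Complex.exp (x * Complex.I) - (0 + (x * Complex.I) ^ 0 / ((1 : ℕ) : ℂ) +
        (x * Complex.I) ^ 1 / (((0 + 1) * 1 : ℕ) : ℂ) +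
        (x * Complex.I) ^ 2 / (((1 + 1) * ((0 + 1) * 1) : ℕ) : ℂ)) := by
    push_cast
    rw [show ((x : ℂ) * Complex.I) ^ 2 = -(x : ℂ) ^ 2 by rw [mul_pow, Complex.I_sq]; ring]
    ring
  rw [e]
  refine h.trans (div_le_self (by positivity) ?_)
  norm_num

theorem norm_exp_sub_exp_le {a b : ℂ} (ha : a.re ≤ 0) (hb : b.re ≤ 0) :
    ‖Complex.exp a - Complex.exp b‖ ≤ ‖a - b‖ := by
  have h := Convex.norm_image_sub_le_of_norm_hasDerivWithin_le (𝕜 := ℂ) (f := Complex.exp)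
    (f' := Complex.exp) (s := {z : ℂ | z.re ≤ 0}) (C := 1)
    (fun x _ => (Complex.hasDerivAt_exp x).hasDerivWithinAt)
    (fun x hx => by rw [Complex.norm_exp]; exact Real.exp_le_one_iff.2 hx)
    (convex_halfSpace_re_le 0) hb ha
  simpa using h

theorem norm_prod_sub_prod_le {ι : Type*} (s : Finset ι) {a b : ι → ℂ}
    (ha : ∀ i ∈ s, ‖a i‖ ≤ 1) (hb : ∀ i ∈ s, ‖b i‖ ≤ 1) :
    ‖∏ i ∈ s, a i - ∏ i ∈ s, b i‖ ≤ ∑ i ∈ s, ‖a i - b i‖ := by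
  classical
  induction s using Finset.induction_on with
  | empty => simp
  | insert i s hi ih =>
    rw [Finset.prod_insert hi, Finset.prod_insert hi, Finset.sum_insert hi]
    have h1 := ih (fun j hj => ha j (Finset.mem_insert_of_mem hj))
      (fun j hj => hb j (Finset.mem_insert_of_mem hj))
    have h2 : ‖∏ j ∈ s, a j‖ ≤ 1 := by
      rw [norm_prod]
      exact Finset.prod_le_one (fun _ _ => norm_nonneg _)
        fun j hj => ha j (Finset.mem_insert_of_mem hj)
    calc _ = ‖(a i - b i) * ∏ j ∈ s, a j + b i * (∏ j ∈ s, a j - ∏ j ∈ s, b j)‖ := by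
          congr 1; ring
      _ ≤ ‖a i - b i‖ * ‖∏ j ∈ s, a j‖ + ‖b i‖ * ‖∏ j ∈ s, a j - ∏ j ∈ s, b j‖ := by
          refine (norm_add_le _ _).trans ?_
          rw [norm_mul, norm_mul]
      _ ≤ ‖a i - b i‖ * 1 + 1 * ∑ j ∈ s, ‖a j - b j‖ := by
          gcongr
          exact hb i (Finset.mem_insert_self _ _)
      _ = _ := by ring

theorem sum_inv_sq_primesLE_le (y : ℕ) : ∑ p ∈ Nat.primesLE y, ((p : ℝ) ^ 2)⁻¹ ≤ 3 / 4 := by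
  have key (n : ℕ) : ∑ p ∈ Finset.Ioc 1 (n + 2), ((p : ℝ) ^ 2)⁻¹ ≤ 3 / 4 - ((n : ℝ) + 2)⁻¹ := by
    induction n with
    | zero => norm_num
    | succ n ih =>
      rw [show n + 1 + 2 = n + 2 + 1 by ring, ← Finset.insert_Ioc_right_eq_Ioc_add_one (by omega),
        Finset.sum_insert (by simp)]
      have : (((n + 2 + 1 : ℕ) : ℝ) ^ 2)⁻¹ ≤ ((n : ℝ) + 2)⁻¹ - ((n : ℝ) + 1 + 2)⁻¹ := by
        push_cast
        rw [inv_sub_inv (by positivity) (by positivity), inv_eq_one_div,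
          div_le_div_iff₀ (by positivity) (by positivity)]
        nlinarith
      push_cast at *
      linarith
  refine (Finset.sum_le_sum_of_subset_of_nonneg (t := Finset.Ioc 1 (y + 2)) (fun p hp => ?_)
    fun _ _ _ => by positivity).trans ((key y).trans ?_)
  · rw [Nat.mem_primesLE] at hp
    exact Finset.mem_Ioc.2 ⟨hp.2.one_lt, by omega⟩
  · have : (0 : ℝ) ≤ ((y : ℝ) + 2)⁻¹ := by positivity
    linarith

end LegendreAdditive

namespace LegendreAdditive

open Filter Topology

/-! ### The distribution of `primeSum` over a full period -/

theorem mean_exp_mul_primeSum (f : ℕ → ℝ) (y : ℕ) (s : ℂ) :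
    mean (∏ p ∈ Nat.primesLE y, p) (fun m => Complex.exp (s * primeSum f y m)) =
      ∏ p ∈ Nat.primesLE y, (1 + (Complex.exp (s * f p) - 1) / p) := by
  rw [← mean_prod_ite_dvd fun p hp => Nat.prime_of_mem_primesLE hp]
  congr 1
  funext m
  rw [primeSum, Complex.ofReal_sum, Finset.mul_sum, Complex.exp_sum]
  refine Finset.prod_congr rfl fun p _ => ?_
  split_ifs <;> simp

theorem mean_exp_mul_primeSum_le {f : ℕ → ℝ} (hf : ∀ p, |f p| ≤ 1) (y : ℕ) {s : ℝ}
    (hs : |s| ≤ 1) :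
    mean (∏ p ∈ Nat.primesLE y, p) (fun m => Real.exp (s * primeSum f y m)) ≤
      Real.exp (|s| * |∑ p ∈ Nat.primesLE y, f p / p| +
        s ^ 2 * ∑ p ∈ Nat.primesLE y, f p ^ 2 / p) := by
  have e : mean (∏ p ∈ Nat.primesLE y, p) (fun m => Real.exp (s * primeSum f y m)) =
      ∏ p ∈ Nat.primesLE y, (1 + (Real.exp (s * f p) - 1) / p) := by
    have := mean_exp_mul_primeSum f y s
    simp only [← Complex.ofReal_mul, ← Complex.ofReal_exp] at this
    rw [← ofReal_mean] at this
    exact_mod_cast this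
  rw [e]
  calc _ ≤ ∏ p ∈ Nat.primesLE y, Real.exp ((s * f p + s ^ 2 * f p ^ 2) / p) := by
        refine Finset.prod_le_prod (fun p hp => ?_) fun p hp => ?_
        · have hp1 : (1 : ℝ) ≤ p := by exact_mod_cast (Nat.prime_of_mem_primesLE hp).one_le
          have : -1 ≤ (Real.exp (s * f p) - 1) / p := by
            rw [le_div_iff₀ (by linarith)]
            linarith [Real.exp_pos (s * f p)]
          linarith
        · rw [add_comm]
          refine (Real.add_one_le_exp _).trans (Real.exp_le_exp.2 ?_)
          gcongr
          have h1 : |s * f p| ≤ 1 := by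
            rw [abs_mul]; exact mul_le_one₀ hs (abs_nonneg _) (hf p)
          have := (abs_le.1 (Real.abs_exp_sub_one_sub_id_le h1)).2
          nlinarith
    _ = Real.exp (s * ∑ p ∈ Nat.primesLE y, f p / p +
          s ^ 2 * ∑ p ∈ Nat.primesLE y, f p ^ 2 / p) := by
        rw [← Real.exp_sum, Finset.mul_sum, Finset.mul_sum, ← Finset.sum_add_distrib]
        congr 1
        exact Finset.sum_congr rfl fun p _ => by ring
    _ ≤ _ := by
        have := le_abs_self (s * ∑ p ∈ Nat.primesLE y, f p / p)
        rw [abs_mul] at this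
        gcongr

theorem norm_mean_exp_mul_primeSum_sub_le {f : ℕ → ℝ} (hf : ∀ p, |f p| ≤ 1) (y : ℕ) {u : ℝ}
    (hu : |u| ≤ 1) :
    ‖mean (∏ p ∈ Nat.primesLE y, p)
        (fun m => Complex.exp ((u * primeSum f y m : ℝ) * Complex.I)) -
      Complex.exp (-(u ^ 2 * ∑ p ∈ Nat.primesLE y, f p ^ 2 / p : ℝ) / 2)‖ ≤
      u ^ 2 + |u| * |∑ p ∈ Nat.primesLE y, f p / p| +
        |u| ^ 3 * ∑ p ∈ Nat.primesLE y, f p ^ 2 / p := by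
  set z : ℕ → ℂ := fun p => (Complex.exp ((u * f p : ℝ) * Complex.I) - 1) / p with hz
  set A := ∑ p ∈ Nat.primesLE y, f p / p with hA
  set V := ∑ p ∈ Nat.primesLE y, f p ^ 2 / p with hV
  have e : mean (∏ p ∈ Nat.primesLE y, p)
      (fun m => Complex.exp ((u * primeSum f y m : ℝ) * Complex.I)) =
      ∏ p ∈ Nat.primesLE y, (1 + z p) := by
    have hc (t : ℝ) : ((u * t : ℝ) : ℂ) * Complex.I = u * Complex.I * t := by push_cast; ring
    simp only [hz, hc]
    exact mean_exp_mul_primeSum f y (u * Complex.I)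
  have hznorm (p : ℕ) : ‖z p‖ ≤ |u| / p := by
    rw [hz]
    simp only [norm_div, Complex.norm_natCast]
    gcongr
    refine (norm_exp_mul_I_sub_one_le _).trans ?_
    rw [abs_mul]
    exact mul_le_of_le_one_right (abs_nonneg _) (hf p)
  have hzre (p : ℕ) : (z p).re ≤ 0 := by
    rw [hz]
    simp only [Complex.div_natCast_re, Complex.sub_re, Complex.exp_ofReal_mul_I_re, Complex.one_re]
    exact div_nonpos_of_nonpos_of_nonneg (by linarith [Real.cos_le_one (u * f p)])
      (Nat.cast_nonneg _)
  have h1 : ‖∏ p ∈ Nat.primesLE y, (1 + z p) - ∏ p ∈ Nat.primesLE y, Complex.exp (z p)‖ ≤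
      u ^ 2 := by
    refine (norm_prod_sub_prod_le _ (fun p hp => ?_) fun p _ => ?_).trans ?_
    · have hp1 : (1 : ℝ) ≤ p := by exact_mod_cast (Nat.prime_of_mem_primesLE hp).one_le
      have hp0 : (p : ℂ) ≠ 0 := by
        exact_mod_cast (Nat.prime_of_mem_primesLE hp).ne_zero
      have : 1 + z p = ((p - 1 : ℝ) + Complex.exp ((u * f p : ℝ) * Complex.I)) / p := by
        rw [hz]; push_cast; field_simp; ring
      rw [this, norm_div, Complex.norm_natCast, div_le_one (by linarith)]
      refine (norm_add_le _ _).trans ?_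
      rw [Complex.norm_exp_ofReal_mul_I, Complex.norm_real, Real.norm_of_nonneg (by linarith)]
      linarith
    · rw [Complex.norm_exp]
      exact Real.exp_le_one_iff.2 (hzre p)
    · calc _ ≤ ∑ p ∈ Nat.primesLE y, u ^ 2 * ((p : ℝ) ^ 2)⁻¹ := by
            refine Finset.sum_le_sum fun p hp => ?_
            have hp1 : (1 : ℝ) ≤ p := by exact_mod_cast (Nat.prime_of_mem_primesLE hp).one_le
            have hz1 : ‖z p‖ ≤ 1 := (hznorm p).trans
              ((div_le_one (by linarith)).2 (hu.trans hp1))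
            rw [norm_sub_rev, ← sub_sub]
            refine (Complex.norm_exp_sub_one_sub_id_le hz1).trans ?_
            calc ‖z p‖ ^ 2 ≤ (|u| / p) ^ 2 := by gcongr; exact hznorm p
              _ = _ := by rw [div_pow, sq_abs, div_eq_mul_inv]
        _ ≤ u ^ 2 := by
            rw [← Finset.mul_sum]
            exact mul_le_of_le_one_right (sq_nonneg u)
              ((sum_inv_sq_primesLE_le y).trans (by norm_num))
  have h2 : ‖∑ p ∈ Nat.primesLE y, z p - -(u ^ 2 * V : ℝ) / 2‖ ≤ |u| * |A| + |u| ^ 3 * V := by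
    have e2 : ∑ p ∈ Nat.primesLE y, z p - -(u ^ 2 * V : ℝ) / 2 =
        ∑ p ∈ Nat.primesLE y, (Complex.exp ((u * f p : ℝ) * Complex.I) - 1 -
          (u * f p : ℝ) * Complex.I + (u * f p : ℝ) ^ 2 / 2) / p + (u * A : ℝ) * Complex.I := by
      rw [hA, hV, hz]
      push_cast
      rw [Finset.mul_sum, Finset.mul_sum, Finset.sum_mul, ← Finset.sum_add_distrib,
        neg_div, sub_neg_eq_add, Finset.sum_div, ← Finset.sum_add_distrib]
      exact Finset.sum_congr rfl fun p _ => by ring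
    rw [e2, add_comm]
    refine (norm_add_le _ _).trans (add_le_add (by simp) ?_)
    rw [hV, Finset.mul_sum]
    refine norm_sum_le_of_le _ fun p _ => ?_
    rw [norm_div, Complex.norm_natCast, ← mul_div_assoc]
    gcongr
    refine (norm_exp_mul_I_sub_quadratic_le _).trans ?_
    rw [abs_mul, mul_pow]
    gcongr
    rw [← sq_abs (f p)]
    exact pow_le_pow_of_le_one (abs_nonneg _) (hf p) (by norm_num)
  rw [e]
  calc _ ≤ ‖∏ p ∈ Nat.primesLE y, (1 + z p) - ∏ p ∈ Nat.primesLE y, Complex.exp (z p)‖ +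
        ‖∏ p ∈ Nat.primesLE y, Complex.exp (z p) - Complex.exp (-(u ^ 2 * V : ℝ) / 2)‖ :=
      norm_sub_le_norm_sub_add_norm_sub _ _ _
    _ ≤ u ^ 2 + (|u| * |A| + |u| ^ 3 * V) := by
      gcongr
      rw [← Complex.exp_sum]
      refine (norm_exp_sub_exp_le ?_ ?_).trans h2
      · rw [Complex.re_sum]
        exact Finset.sum_nonpos fun p _ => hzre p
      · have : 0 ≤ V := Finset.sum_nonneg fun p _ => by positivity
        rw [← Complex.ofReal_neg, ← Complex.ofReal_ofNat, ← Complex.ofReal_div, Complex.ofReal_re]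
        have := mul_nonneg (sq_nonneg u) this
        linarith
    _ = _ := by ring

end LegendreAdditive

namespace LegendreAdditive

open Filter Topology

/-! ### Comparison of the uniform distribution on `1, …, N` with a full period -/

theorem mean_pow_div_factorial_le {f : ℕ → ℝ} (hf : ∀ p, |f p| ≤ 1) (y k : ℕ) {u : ℝ}
    (hu : |u| ≤ 1 / 2) :
    mean (∏ p ∈ Nat.primesLE y, p) (fun m => |u * primeSum f y m| ^ k / k.factorial) ≤
      2 * (1 / 2) ^ k * Real.exp (2 * |u| * |∑ p ∈ Nat.primesLE y, f p / p| +
        4 * u ^ 2 * ∑ p ∈ Nat.primesLE y, f p ^ 2 / p) := by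
  have h2u : |2 * u| ≤ 1 := by rw [abs_mul, abs_two]; linarith
  have h1 := mean_exp_mul_primeSum_le hf y h2u
  have h2 := mean_exp_mul_primeSum_le hf y (s := -(2 * u)) (by rwa [abs_neg])
  rw [abs_neg, neg_sq] at h2
  have e : |2 * u| * |∑ p ∈ Nat.primesLE y, f p / p| +
      (2 * u) ^ 2 * ∑ p ∈ Nat.primesLE y, f p ^ 2 / p =
      2 * |u| * |∑ p ∈ Nat.primesLE y, f p / p| +
        4 * u ^ 2 * ∑ p ∈ Nat.primesLE y, f p ^ 2 / p := by
    rw [abs_mul, abs_two]; ring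
  rw [e] at h1 h2
  calc _ ≤ mean (∏ p ∈ Nat.primesLE y, p) (fun m => (1 / 2) ^ k *
        (Real.exp (2 * u * primeSum f y m) + Real.exp (-(2 * u) * primeSum f y m))) := by
        refine mean_mono fun m _ => ?_
        have h := Real.pow_div_factorial_le_exp _ (abs_nonneg (2 * u * primeSum f y m)) k
        have h' : Real.exp |2 * u * primeSum f y m| ≤
            Real.exp (2 * u * primeSum f y m) + Real.exp (-(2 * u) * primeSum f y m) := by
          rcases abs_choice (2 * u * primeSum f y m) with h | h <;> rw [h]
          · linarith [Real.exp_pos (-(2 * u) * primeSum f y m)]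
          · rw [neg_mul]
            linarith [Real.exp_pos (2 * u * primeSum f y m)]
        calc _ = (1 / 2) ^ k * (|2 * u * primeSum f y m| ^ k / k.factorial) := by
              rw [mul_assoc, abs_mul 2, abs_two, mul_pow 2, ← mul_div_assoc, ← mul_assoc, ← mul_pow]
              norm_num
          _ ≤ _ := by gcongr; exact h.trans h'
    _ ≤ _ := by
        rw [mean_const_mul, mean_add]
        have : (0 : ℝ) ≤ (1 / 2) ^ k := by positivity
        nlinarith

theorem norm_mean_exp_sub_mean_exp_le {f : ℕ → ℝ} (hf : ∀ p, |f p| ≤ 1) {N y k : ℕ}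
    (hk : Even k) (hk0 : k ≠ 0) (hN : 0 < N) (hy : y ^ k ≤ N) (hy0 : 0 < y) {u : ℝ}
    (hu : |u| ≤ 1 / 2) :
    ‖mean N (fun m => Complex.exp ((u * primeSum f y m : ℝ) * Complex.I)) -
      mean (∏ p ∈ Nat.primesLE y, p)
        (fun m => Complex.exp ((u * primeSum f y m : ℝ) * Complex.I))‖ ≤
      (k + 1) * |u| + 4 * (1 / 2) ^ k *
        Real.exp (2 * |u| * |∑ p ∈ Nat.primesLE y, f p / p| +
          4 * u ^ 2 * ∑ p ∈ Nat.primesLE y, f p ^ 2 / p) := by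
  set M := ∏ p ∈ Nat.primesLE y, p with hM
  set S := primeSum f y with hS
  set E := Real.exp (2 * |u| * |∑ p ∈ Nat.primesLE y, f p / p| +
          4 * u ^ 2 * ∑ p ∈ Nat.primesLE y, f p ^ 2 / p) with hE
  set T : ℕ → ℂ := fun m => ∑ j ∈ Finset.range k,
    ((u * S m : ℝ) * Complex.I) ^ j / (j.factorial : ℂ) with hT
  have hu1 : |u| ≤ 1 := hu.trans (by norm_num)
  have hN' : (0 : ℝ) < N := by exact_mod_cast hN
  have hmom {j : ℕ} (hj : j ≤ k) : |mean N (fun m => S m ^ j) - mean M (fun m => S m ^ j)| ≤ 1 := by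
    refine (abs_mean_primeSum_pow_sub_le hf hN y j).trans ((div_le_one hN').2 ?_)
    exact_mod_cast (Nat.pow_le_pow_right hy0 hj).trans hy
  have hrem (L : ℕ) : ‖mean L (fun m => Complex.exp ((u * S m : ℝ) * Complex.I)) - mean L T‖ ≤
      mean L (fun m => |u * S m| ^ k / k.factorial) := by
    rw [← mean_sub]
    exact norm_mean_le fun m _ => norm_exp_mul_I_sub_sum_le _ _
  have hcoef {j : ℕ} (hj : j ≠ 0) : |u| ^ j / j.factorial ≤ |u| := by
    refine (div_le_self (by positivity) (by exact_mod_cast j.factorial_pos)).trans ?_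
    simpa using pow_le_pow_of_le_one (abs_nonneg u) hu1 (Nat.one_le_iff_ne_zero.2 hj)
  have hmodel : mean M (fun m => |u * S m| ^ k / k.factorial) ≤ 2 * (1 / 2) ^ k * E :=
    mean_pow_div_factorial_le hf y k hu
  have hactual : mean N (fun m => |u * S m| ^ k / k.factorial) ≤ 2 * (1 / 2) ^ k * E + |u| := by
    have e (L : ℕ) : mean L (fun m => |u * S m| ^ k / k.factorial) =
        |u| ^ k / k.factorial * mean L (fun m => S m ^ k) := by
      rw [← mean_const_mul]
      congr 1
      funext m
      rw [abs_mul, mul_pow, hk.pow_abs (S m)]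
      ring
    have h1 := (abs_le.1 (hmom le_rfl)).2
    have h2 := hcoef hk0
    have h3 : 0 ≤ |u| ^ k / k.factorial := by positivity
    rw [e] at hmodel ⊢
    nlinarith
  have hpoly : ‖mean N T - mean M T‖ ≤ k * |u| := by
    rw [hT, mean_sum, mean_sum, ← Finset.sum_sub_distrib]
    have : ∀ j ∈ Finset.range k,
        ‖mean N (fun m => ((u * S m : ℝ) * Complex.I) ^ j / (j.factorial : ℂ)) -
          mean M (fun m => ((u * S m : ℝ) * Complex.I) ^ j / (j.factorial : ℂ))‖ ≤ |u| := by
      intro j hj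
      have e (L : ℕ) : mean L (fun m => ((u * S m : ℝ) * Complex.I) ^ j / (j.factorial : ℂ)) =
          (u * Complex.I) ^ j / (j.factorial : ℂ) * (mean L (fun m => S m ^ j) : ℝ) := by
        rw [ofReal_mean, ← mean_const_mul]
        congr 1
        funext m
        push_cast
        ring
      rw [e, e, ← mul_sub, ← Complex.ofReal_sub, norm_mul, Complex.norm_real, Real.norm_eq_abs,
        norm_div, norm_pow, norm_mul, Complex.norm_I, mul_one, Complex.norm_real,
        Real.norm_eq_abs, Complex.norm_natCast]
      rcases Nat.eq_zero_or_pos j with rfl | hj0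
      · have hM0 : (M : ℝ) ≠ 0 := Nat.cast_ne_zero.2
          (Finset.prod_ne_zero_iff.2 fun p hp => (Nat.prime_of_mem_primesLE hp).ne_zero)
        simp [mean, hM0, hN'.ne']
      · refine (mul_le_of_le_one_right (by positivity) (hmom (Finset.mem_range.1 hj).le)).trans ?_
        exact hcoef hj0.ne'
    exact (norm_sum_le_of_le _ this).trans (by simp)
  calc _ = ‖(mean N (fun m => Complex.exp ((u * S m : ℝ) * Complex.I)) - mean N T) +
        (mean N T - mean M T) -
        (mean M (fun m => Complex.exp ((u * S m : ℝ) * Complex.I)) - mean M T)‖ := by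
        congr 1; ring
    _ ≤ (2 * (1 / 2) ^ k * E + |u|) + k * |u| + 2 * (1 / 2) ^ k * E := by
        refine (norm_sub_le _ _).trans
          (add_le_add ((norm_add_le _ _).trans (add_le_add ?_ hpoly)) ?_)
        · exact (hrem N).trans hactual
        · exact (hrem M).trans hmodel
    _ = _ := by ring

end LegendreAdditive

namespace LegendreAdditive

open Filter Topology

/-! ### A central limit theorem -/

/-- The sum of `f` over the primes dividing `m` to an odd power. -/
def oddPrimeSum (f : ℕ → ℝ) (m : ℕ) : ℝ :=
  ∑ p ∈ m.primeFactors with Odd (m.factorization p), f p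

theorem primesLE_subset {y N : ℕ} (h : y ≤ N) : Nat.primesLE y ⊆ Nat.primesLE N := fun p hp => by
  rw [Nat.mem_primesLE] at hp ⊢
  exact ⟨hp.1.trans h, hp.2⟩

theorem oddPrimeSum_eq (f : ℕ → ℝ) {m N : ℕ} (hm : m ∈ Finset.Ioc 0 N) :
    oddPrimeSum f m = ∑ p ∈ Nat.primesLE N, if Odd (m.factorization p) then f p else 0 := by
  rw [Finset.mem_Ioc] at hm
  rw [oddPrimeSum, Finset.sum_filter]
  refine Finset.sum_subset (fun p hp => ?_) fun p _ hp => ?_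
  · rw [Nat.mem_primesLE]
    exact ⟨(Nat.le_of_mem_primeFactors hp).trans hm.2, Nat.prime_of_mem_primeFactors hp⟩
  · rw [← Nat.support_factorization, Finsupp.notMem_support_iff] at hp
    simp [hp]

theorem abs_oddPrimeSum_sub_primeSum_le {f : ℕ → ℝ} (hf : ∀ p, |f p| ≤ 1) {y N m : ℕ}
    (hy : y ≤ N) (hm : m ∈ Finset.Ioc 0 N) :
    |oddPrimeSum f m - primeSum f y m| ≤
      ∑ p ∈ Nat.primesLE N \ Nat.primesLE y, (if p ∣ m then 1 else 0) +
        ∑ p ∈ Nat.primesLE y, if p ^ 2 ∣ m then 1 else 0 := by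
  have hm0 : m ≠ 0 := (Finset.mem_Ioc.1 hm).1.ne'
  rw [oddPrimeSum_eq f hm, ← Finset.sum_sdiff (primesLE_subset hy), primeSum, add_sub_assoc,
    ← Finset.sum_sub_distrib]
  refine (abs_add_le _ _).trans (add_le_add ?_ ?_)
  · refine (Finset.abs_sum_le_sum_abs _ _).trans (Finset.sum_le_sum fun p hp => ?_)
    split_ifs with h1 h2
    · exact hf p
    · rw [Nat.factorization_eq_zero_of_not_dvd h2] at h1
      simp at h1
    · simp
    · simp
  · refine (Finset.abs_sum_le_sum_abs _ _).trans (Finset.sum_le_sum fun p hp => ?_)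
    have hp' := Nat.prime_of_mem_primesLE hp
    simp only [hp'.pow_dvd_iff_le_factorization hm0, hp'.dvd_iff_one_le_factorization hm0]
    split_ifs with h1 h2 h3 h4 h5
    · simp
    · simp
    · obtain ⟨a, ha⟩ := h1
      omega
    · obtain ⟨a, ha⟩ := h1
      omega
    · simpa using hf p
    · have : m.factorization p = 1 := by omega
      exact absurd (this ▸ odd_one) h1
    · simp
    · simp

theorem mean_abs_oddPrimeSum_sub_le {f : ℕ → ℝ} (hf : ∀ p, |f p| ≤ 1) {y N : ℕ} (hy : y ≤ N) :
    mean N (fun m => |oddPrimeSum f m - primeSum f y m|) ≤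
      ∑ p ∈ Nat.primesLE N \ Nat.primesLE y, (p : ℝ)⁻¹ + 1 := by
  refine (mean_mono fun m hm => abs_oddPrimeSum_sub_primeSum_le hf hy hm).trans ?_
  rw [mean_add, mean_sum, mean_sum]
  refine add_le_add (Finset.sum_le_sum fun p _ => mean_dvd_le N) ?_
  refine (Finset.sum_le_sum fun p _ => mean_dvd_le N).trans ?_
  simpa using (sum_inv_sq_primesLE_le y).trans (by norm_num)

theorem norm_exp_mul_I_sub_exp_mul_I_le (a b : ℝ) :
    ‖Complex.exp (a * Complex.I) - Complex.exp (b * Complex.I)‖ ≤ |a - b| := by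
  refine (norm_exp_sub_exp_le (by simp) (by simp)).trans_eq ?_
  rw [← sub_mul, ← Complex.ofReal_sub, norm_mul, Complex.norm_I, mul_one, Complex.norm_real,
    Real.norm_eq_abs]

theorem norm_sub_le_of_le_of_le {a b c : ℂ} {r s : ℝ} (h1 : ‖a - b‖ ≤ r) (h2 : ‖b - c‖ ≤ s) :
    ‖a - c‖ ≤ r + s :=
  (norm_sub_le_norm_sub_add_norm_sub a b c).trans (add_le_add h1 h2)

theorem exists_pow_le_lt {N k : ℕ} (hk : k ≠ 0) (hN : 2 ^ k ≤ N) :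
    ∃ y, 2 ≤ y ∧ y ^ k ≤ N ∧ N ≤ y ^ (2 * k) := by
  refine ⟨Nat.nthRoot k N, ?_, ?_, ?_⟩
  · exact (Nat.le_nthRoot_iff hk).2 hN
  · exact Nat.pow_nthRoot_le (Or.inl hk)
  · have h2 : 2 ≤ Nat.nthRoot k N := (Nat.le_nthRoot_iff hk).2 hN
    have := (Nat.lt_pow_nthRoot_add_one hk N).le
    refine this.trans ?_
    rw [pow_mul]
    exact Nat.pow_le_pow_left (by nlinarith) k

theorem norm_mean_exp_oddPrimeSum_sub_le {f : ℕ → ℝ} (hf : ∀ p, |f p| ≤ 1) {C : ℝ}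
    (hC : ∀ x : ℕ, |∑ p ∈ Nat.primesLE x, f p / p| ≤ C) {j N : ℕ} (hj : j ≠ 0)
    (hN : 2 ^ 2 ^ j ≤ N) {u : ℝ} (hu : |u| ≤ 1 / 2) :
    ‖mean N (fun m => Complex.exp ((u * oddPrimeSum f m : ℝ) * Complex.I)) -
      Complex.exp (-(u ^ 2 * ∑ p ∈ Nat.primesLE N, f p ^ 2 / p : ℝ) / 2)‖ ≤
      |u| * (6 * j + 9 + 2 ^ j + C + u ^ 2 * ∑ p ∈ Nat.primesLE N, f p ^ 2 / p) +
        4 * (1 / 2) ^ 2 ^ j *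
          Real.exp (2 * C + 4 * u ^ 2 * ∑ p ∈ Nat.primesLE N, f p ^ 2 / p) := by
  have hk0 : 2 ^ j ≠ 0 := by positivity
  obtain ⟨y, hy2, hyN, hNy⟩ := exists_pow_le_lt hk0 hN
  have hyleN : y ≤ N := (Nat.le_self_pow hk0 y).trans hyN
  have hsdiff : ∑ p ∈ Nat.primesLE N \ Nat.primesLE y, (p : ℝ)⁻¹ ≤ 4 * (j + 1) := by
    have := sum_inv_primesLE_pow_sdiff_le hy2 (j + 1)
    push_cast at this
    refine le_trans ?_ this
    refine Finset.sum_le_sum_of_subset_of_nonneg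
      (Finset.sdiff_subset_sdiff (primesLE_subset ?_) le_rfl) fun _ _ _ => by positivity
    rwa [pow_succ' 2 j]
  set VN := ∑ p ∈ Nat.primesLE N, f p ^ 2 / p with hVN
  set Vy := ∑ p ∈ Nat.primesLE y, f p ^ 2 / p with hVy
  set S := primeSum f y
  set M := ∏ p ∈ Nat.primesLE y, p
  have hVy0 : 0 ≤ Vy := Finset.sum_nonneg fun p _ => by positivity
  have hVle : Vy ≤ VN := Finset.sum_le_sum_of_subset_of_nonneg (primesLE_subset hyleN)
    fun _ _ _ => by positivity
  have hVsub : VN - Vy ≤ 4 * (j + 1) := by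
    refine le_trans ?_ hsdiff
    rw [hVN, hVy, ← Finset.sum_sdiff (primesLE_subset hyleN), add_sub_cancel_right]
    refine Finset.sum_le_sum fun p _ => ?_
    rw [div_eq_mul_inv]
    refine mul_le_of_le_one_left (by positivity) ?_
    rw [← sq_abs]
    exact pow_le_one₀ (abs_nonneg _) (hf p)
  have hu0 := abs_nonneg u
  have husq : u ^ 2 ≤ |u| := by rw [← sq_abs]; nlinarith
  have hC0 := (abs_nonneg _).trans (hC y)
  have hd1 : ‖mean N (fun m => Complex.exp ((u * oddPrimeSum f m : ℝ) * Complex.I)) -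
      mean N (fun m => Complex.exp ((u * S m : ℝ) * Complex.I))‖ ≤ |u| * (4 * (j + 1) + 1) := by
    rw [← mean_sub]
    refine (norm_mean_le (G := fun m => |u| * |oddPrimeSum f m - S m|) fun m _ => ?_).trans ?_
    · refine (norm_exp_mul_I_sub_exp_mul_I_le _ _).trans_eq ?_
      rw [← mul_sub, abs_mul]
    · rw [mean_const_mul]
      gcongr
      exact (mean_abs_oddPrimeSum_sub_le hf hyleN).trans (by gcongr)
  have hd2 := norm_mean_exp_sub_mean_exp_le hf (N := N) (y := y) (k := 2 ^ j) (u := u)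
    ((Nat.even_pow).2 ⟨even_two, hj⟩) hk0 (by omega) hyN (by omega) hu
  have hd3 := norm_mean_exp_mul_primeSum_sub_le hf y (u := u) (by linarith)
  have hd4 : ‖Complex.exp (-(u ^ 2 * Vy : ℝ) / 2) - Complex.exp (-(u ^ 2 * VN : ℝ) / 2)‖ ≤
      |u| * (2 * (j + 1)) := by
    have hre (V : ℝ) (hV : 0 ≤ V) : (-((u ^ 2 * V : ℝ) : ℂ) / 2).re ≤ 0 := by
      rw [← Complex.ofReal_neg, ← Complex.ofReal_ofNat, ← Complex.ofReal_div, Complex.ofReal_re]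
      have := mul_nonneg (sq_nonneg u) hV
      linarith
    refine (norm_exp_sub_exp_le (hre _ hVy0) (hre _ (hVy0.trans hVle))).trans ?_
    have : (-(u ^ 2 * Vy : ℝ) / 2 - -(u ^ 2 * VN : ℝ) / 2 : ℂ) =
        ((u ^ 2 * (VN - Vy) / 2 : ℝ) : ℂ) := by push_cast; ring
    rw [this, Complex.norm_real, Real.norm_eq_abs, abs_of_nonneg
      (div_nonneg (mul_nonneg (sq_nonneg u) (sub_nonneg.2 hVle)) zero_le_two)]
    nlinarith
  have hexp : Real.exp (2 * |u| * |∑ p ∈ Nat.primesLE y, f p / p| + 4 * u ^ 2 * Vy) ≤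
      Real.exp (2 * C + 4 * u ^ 2 * VN) := by
    have h := mul_le_mul (show 2 * |u| ≤ 2 by linarith) (hC y) (abs_nonneg _) zero_le_two
    have h' := mul_le_mul_of_nonneg_left hVle (show 0 ≤ 4 * u ^ 2 by positivity)
    exact Real.exp_le_exp.2 (add_le_add h h')
  have hd2' := hd2.trans (add_le_add_right (mul_le_mul_of_nonneg_left hexp (by positivity)) _)
  have hcube : |u| ^ 3 * Vy ≤ |u| * (u ^ 2 * VN) := by
    rw [← sq_abs u, ← mul_assoc, ← pow_succ']
    gcongr
  have hA : |u| * |∑ p ∈ Nat.primesLE y, f p / p| ≤ |u| * C := by gcongr; exact hC y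
  rw [Nat.cast_pow, Nat.cast_ofNat] at hd2'
  calc _ ≤ |u| * (4 * (j + 1) + 1) + ((((2 : ℝ) ^ j + 1) * |u| + 4 * (1 / 2) ^ 2 ^ j *
          Real.exp (2 * C + 4 * u ^ 2 * VN)) +
        ((u ^ 2 + |u| * |∑ p ∈ Nat.primesLE y, f p / p| + |u| ^ 3 * Vy) + |u| * (2 * (j + 1)))) :=
        norm_sub_le_of_le_of_le hd1 (norm_sub_le_of_le_of_le hd2'
          (norm_sub_le_of_le_of_le hd3 hd4))
    _ ≤ _ := by
        generalize 4 * (1 / 2) ^ 2 ^ j * Real.exp (2 * C + 4 * u ^ 2 * VN) = E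
        generalize (2 : ℝ) ^ j = K
        linarith

theorem tendsto_mean_exp_oddPrimeSum {f : ℕ → ℝ} (hf : ∀ p, |f p| ≤ 1) {C : ℝ}
    (hC : ∀ x : ℕ, |∑ p ∈ Nat.primesLE x, f p / p| ≤ C)
    (hV : Tendsto (fun N => ∑ p ∈ Nat.primesLE N, f p ^ 2 / p) atTop atTop) (t : ℝ) :
    Tendsto (fun N => mean N fun m =>
      Complex.exp ((t / √(∑ p ∈ Nat.primesLE N, f p ^ 2 / p) * oddPrimeSum f m : ℝ) * Complex.I))
      atTop (𝓝 (Complex.exp (-(t ^ 2 : ℝ) / 2))) := by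
  set V : ℕ → ℝ := fun N => ∑ p ∈ Nat.primesLE N, f p ^ 2 / p with hVdef
  have hu : Tendsto (fun N => |t / √(V N)|) atTop (𝓝 0) := by
    have : Tendsto (fun N => t / √(V N)) atTop (𝓝 0) :=
      tendsto_const_nhds.div_atTop (Real.tendsto_sqrt_atTop.comp hV)
    simpa using this.abs
  rw [Metric.tendsto_nhds]
  intro ε hε
  have hpow : Tendsto (fun j : ℕ => 4 * (1 / 2 : ℝ) ^ 2 ^ j * Real.exp (2 * C + 4 * t ^ 2))
      atTop (𝓝 (4 * 0 * Real.exp (2 * C + 4 * t ^ 2))) :=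
    (((tendsto_pow_atTop_nhds_zero_of_lt_one (by norm_num) (by norm_num)).comp
      (tendsto_pow_atTop_atTop_of_one_lt one_lt_two)).const_mul 4).mul_const _
  rw [mul_zero, zero_mul] at hpow
  obtain ⟨j, hjε, hj⟩ := ((hpow.eventually (gt_mem_nhds (half_pos hε))).and
    (eventually_ne_atTop 0)).exists
  have hsmall := hu.mul_const (6 * (j : ℝ) + 9 + 2 ^ j + C + t ^ 2)
  rw [zero_mul] at hsmall
  filter_upwards [hsmall.eventually (gt_mem_nhds (half_pos hε)),
    hu.eventually (gt_mem_nhds (show (0 : ℝ) < 1 / 2 by norm_num)),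
    eventually_ge_atTop (2 ^ 2 ^ j), hV.eventually_gt_atTop 0] with N h1 h2 h3 h4
  have h := norm_mean_exp_oddPrimeSum_sub_le hf hC hj h3 h2.le
  have e : (t / √(V N)) ^ 2 * V N = t ^ 2 := by
    rw [div_pow, Real.sq_sqrt h4.le, div_mul_cancel₀ _ h4.ne']
  rw [mul_assoc 4 (_ ^ 2), e] at h
  rw [dist_eq_norm]
  linarith

end LegendreAdditive

namespace LegendreAdditive

open Filter Topology MeasureTheory ProbabilityTheory
open scoped ENNReal

/-! ### From characteristic functions to distribution functions -/

theorem gaussianReal_Ici_zero : (gaussianReal 0 1).real (Set.Ici 0) = 1 / 2 := by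
  have : NullSingletonClass (gaussianReal 0 1) := nullSingletonClass_gaussianReal one_ne_zero
  have h1 : (gaussianReal 0 1).real (Set.Iio 0) = (gaussianReal 0 1).real (Set.Ici 0) := by
    rw [measureReal_congr Ioi_ae_eq_Ici.symm]
    conv_rhs => rw [← neg_zero, ← gaussianReal_map_neg,
      map_measureReal_apply measurable_neg measurableSet_Ioi]
    simp
  have h2 := probReal_compl_eq_one_sub (μ := gaussianReal 0 1) (measurableSet_Ici (a := (0 : ℝ)))
  rw [Set.compl_Ici, h1] at h2
  linarith

/-- The distribution of `Y` under the uniform distribution on `1, …, n + 1`. -/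
noncomputable def valueDist (Y : ℕ → ℝ) (n : ℕ) : Measure ℝ :=
  ((n + 1 : ℕ) : ℝ≥0∞)⁻¹ • ∑ m ∈ Finset.Ioc 0 (n + 1), Measure.dirac (Y m)

instance (Y : ℕ → ℝ) (n : ℕ) : IsProbabilityMeasure (valueDist Y n) := by
  constructor
  simp only [valueDist, Measure.smul_apply, Measure.finsetSum_apply, measure_univ,
    Finset.sum_const, Nat.card_Ioc, smul_eq_mul, nsmul_eq_mul, mul_one, Nat.sub_zero]
  exact ENNReal.inv_mul_cancel (by simp) (ENNReal.natCast_ne_top _)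

theorem charFun_valueDist (Y : ℕ → ℝ) (n : ℕ) (t : ℝ) :
    charFun (valueDist Y n) t =
      mean (n + 1) fun m => Complex.exp ((t * Y m : ℝ) * Complex.I) := by
  rw [charFun_apply_real, valueDist, integral_smul_measure, integral_finsetSum_measure]
  · rw [ENNReal.toReal_inv, ENNReal.toReal_natCast]
    simp [mean, integral_dirac, div_eq_inv_mul]
  · intro m _
    exact integrable_dirac (by simp)

theorem valueDist_real_Ici (Y : ℕ → ℝ) (n : ℕ) :
    (valueDist Y n).real (Set.Ici 0) = mean (n + 1) fun m => if 0 ≤ Y m then 1 else 0 := by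
  rw [Measure.real, valueDist, Measure.smul_apply, smul_eq_mul, ENNReal.toReal_mul,
    ENNReal.toReal_inv, ENNReal.toReal_natCast]
  simp [mean, Measure.dirac_apply' _ measurableSet_Ici,
    Set.indicator_apply, div_eq_inv_mul]

theorem tendsto_mean_nonneg {Y : ℕ → ℕ → ℝ} (hY : ∀ t : ℝ, Tendsto
    (fun N => mean N fun m => Complex.exp ((t * Y N m : ℝ) * Complex.I)) atTop
      (𝓝 (Complex.exp (-(t ^ 2 : ℝ) / 2)))) :
    Tendsto (fun N => mean N fun m => if 0 ≤ Y N m then (1 : ℝ) else 0) atTop (𝓝 (1 / 2)) := by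
  have : NullSingletonClass (gaussianReal 0 1) := nullSingletonClass_gaussianReal one_ne_zero
  let μ : ℕ → ProbabilityMeasure ℝ := fun n => ⟨valueDist (Y (n + 1)) n, inferInstance⟩
  let μ₀ : ProbabilityMeasure ℝ := ⟨gaussianReal 0 1, inferInstance⟩
  have hμ : Tendsto μ atTop (𝓝 μ₀) := by
    refine ProbabilityMeasure.tendsto_iff_tendsto_charFun.2 fun t => ?_
    have h := (hY t).comp (tendsto_add_atTop_nat 1)
    convert h using 2
    · exact charFun_valueDist _ _ _
    · change charFun (gaussianReal 0 1) t = _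
      rw [charFun_gaussianReal]
      congr 1
      push_cast
      simp [neg_div]
  have h := ProbabilityMeasure.tendsto_measure_of_null_frontier_of_tendsto' hμ
    (E := Set.Ici 0) (by rw [frontier_Ici]; exact measure_singleton (μ := gaussianReal 0 1) 0)
  have h' := (ENNReal.tendsto_toReal (measure_ne_top _ _)).comp h
  rw [← tendsto_add_atTop_iff_nat 1]
  convert h' using 2
  · exact (valueDist_real_Ici _ _).symm
  · exact gaussianReal_Ici_zero.symm

theorem tendsto_mean_le_oddPrimeSum {f : ℕ → ℝ} (hf : ∀ p, |f p| ≤ 1) {C : ℝ}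
    (hC : ∀ x : ℕ, |∑ p ∈ Nat.primesLE x, f p / p| ≤ C)
    (hV : Tendsto (fun N => ∑ p ∈ Nat.primesLE N, f p ^ 2 / p) atTop atTop) (r : ℝ) :
    Tendsto (fun N => mean N fun m => if r ≤ oddPrimeSum f m then (1 : ℝ) else 0) atTop
      (𝓝 (1 / 2)) := by
  set V : ℕ → ℝ := fun N => ∑ p ∈ Nat.primesLE N, f p ^ 2 / p with hVdef
  have h := tendsto_mean_nonneg (Y := fun N m => (oddPrimeSum f m - r) / √(V N)) fun t => by
    have h1 : Tendsto (fun N => Complex.exp ((-(t * r / √(V N)) : ℝ) * Complex.I)) atTop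
        (𝓝 (Complex.exp ((-0 : ℝ) * Complex.I))) := by
      have h0 : Tendsto (fun N => t * r / √(V N)) atTop (𝓝 0) :=
        tendsto_const_nhds.div_atTop (Real.tendsto_sqrt_atTop.comp hV)
      exact (Complex.continuous_exp.tendsto _).comp
        (((Complex.continuous_ofReal.tendsto _).comp h0.neg).mul_const _)
    have h2 := h1.mul (tendsto_mean_exp_oddPrimeSum hf hC hV t)
    rw [neg_zero, Complex.ofReal_zero, zero_mul, Complex.exp_zero, one_mul] at h2
    refine h2.congr fun N => ?_
    rw [← mean_const_mul]
    congr 1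
    funext m
    rw [← Complex.exp_add]
    congr 1
    push_cast
    ring
  refine h.congr' ?_
  filter_upwards [hV.eventually_gt_atTop 0] with N hN
  congr 1
  funext m
  simp only [le_div_iff₀ (Real.sqrt_pos.2 hN), zero_mul, sub_nonneg]

end LegendreAdditive

namespace LegendreAdditive

open Filter Topology
open scoped ArithmeticFunction.Moebius

/-! ### Passing to squarefree numbers -/

theorem sum_moebius_sq_dvd {n X : ℕ} (hn : n ∈ Finset.Ioc 0 X) :
    ∑ k ∈ Finset.Ioc 0 X, (if k ^ 2 ∣ n then μ k else 0) = if Squarefree n then 1 else 0 := by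
  obtain ⟨hn0, hnX⟩ := Finset.mem_Ioc.1 hn
  obtain ⟨a, b, ha0, hb0, rfl, ha⟩ := Nat.sq_mul_squarefree_of_pos hn0
  have hdvd (k : ℕ) : k ^ 2 ∣ b ^ 2 * a ↔ k ∣ b := by
    refine ⟨fun h => ?_, fun h => (pow_dvd_pow_of_dvd h 2).mul_right a⟩
    have hk0 : k ≠ 0 := by
      rintro rfl
      exact hn0.ne' (Nat.eq_zero_of_zero_dvd (by simpa using h))
    rw [← Nat.factorization_le_iff_dvd (by positivity) (by positivity)] at h
    rw [← Nat.factorization_le_iff_dvd hk0 hb0.ne']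
    intro p
    have h1 := h p
    have h2 := ha.natFactorization_le_one p
    rw [Nat.factorization_mul (by positivity) ha0.ne'] at h1
    simp only [Nat.factorization_pow, Finsupp.add_apply, Finsupp.smul_apply, smul_eq_mul] at h1
    omega
  have hsq : Squarefree (b ^ 2 * a) ↔ b = 1 := by
    refine ⟨fun h => ?_, fun h => by simpa [h] using ha⟩
    have := h b ⟨a, by ring⟩
    exact Nat.isUnit_iff.1 this
  simp only [hdvd, hsq]
  rw [← Finset.sum_filter]
  have : (Finset.Ioc 0 X).filter (· ∣ b) = b.divisors := by
    ext k
    simp only [Finset.mem_filter, Finset.mem_Ioc, Nat.mem_divisors]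
    refine ⟨fun h => ⟨h.2, hb0.ne'⟩, fun h => ⟨⟨Nat.pos_of_dvd_of_pos h.1 hb0, ?_⟩, h.1⟩⟩
    refine (Nat.le_of_dvd hb0 h.1).trans (le_trans ?_ hnX)
    nlinarith
  rw [this, ← ArithmeticFunction.coe_mul_zeta_apply, ArithmeticFunction.moebius_mul_coe_zeta,
    ArithmeticFunction.one_apply]

theorem sum_sq_dvd {w : ℕ → ℝ} (hw : ∀ k m, k ≠ 0 → m ≠ 0 → w (k ^ 2 * m) = w m) {k : ℕ}
    (hk : k ≠ 0) (X : ℕ) :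
    ∑ n ∈ Finset.Ioc 0 X, (if k ^ 2 ∣ n then w n else 0) =
      ∑ m ∈ Finset.Ioc 0 (X / k ^ 2), w m := by
  have hk2 : 0 < k ^ 2 := by positivity
  have : (Finset.Ioc 0 X).filter (k ^ 2 ∣ ·) = (Finset.Ioc 0 (X / k ^ 2)).image (k ^ 2 * ·) := by
    ext n
    simp only [Finset.mem_filter, Finset.mem_Ioc, Finset.mem_image]
    constructor
    · rintro ⟨⟨h0, hX⟩, m, rfl⟩
      exact ⟨m, ⟨Nat.pos_of_mul_pos_left h0, (Nat.le_div_iff_mul_le hk2).2 (by linarith)⟩, rfl⟩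
    · rintro ⟨m, ⟨h0, hX⟩, rfl⟩
      have := (Nat.le_div_iff_mul_le hk2).1 hX
      exact ⟨⟨by positivity, by linarith⟩, dvd_mul_right _ _⟩
  rw [← Finset.sum_filter, this, Finset.sum_image fun a _ b _ h => Nat.eq_of_mul_eq_mul_left hk2 h]
  exact Finset.sum_congr rfl fun m hm => hw k m hk (Finset.mem_Ioc.1 hm).1.ne'

theorem tendsto_mean_squarefree {w : ℕ → ℝ} (hw : ∀ k m, k ≠ 0 → m ≠ 0 → w (k ^ 2 * m) = w m)
    (hw1 : ∀ m, |w m| ≤ 1) (h : Tendsto (fun N => mean N w) atTop (𝓝 0)) :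
    Tendsto (fun X => mean X fun n => if Squarefree n then w n else 0) atTop (𝓝 0) := by
  have hmean (N : ℕ) : |mean N w| ≤ 1 := by
    rw [mean, abs_div, Nat.abs_cast]
    refine div_le_one_of_le₀ ((Finset.abs_sum_le_sum_abs _ _).trans ?_) (Nat.cast_nonneg _)
    exact (Finset.sum_le_sum fun m _ => hw1 m).trans (by simp)
  set F : ℕ → ℕ → ℝ := fun X k => μ k * mean (X / k ^ 2) w * (((X / k ^ 2 : ℕ) : ℝ) / X) with hF
  have hFle (X k : ℕ) : ‖F X k‖ ≤ |mean (X / k ^ 2) w| * ((k : ℝ) ^ 2)⁻¹ := by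
    rw [hF, Real.norm_eq_abs, abs_mul, abs_mul, abs_div, Nat.abs_cast, Nat.abs_cast]
    have h1 : |(μ k : ℝ)| ≤ 1 := by exact_mod_cast ArithmeticFunction.abs_moebius_le_one
    have h2 : ((X / k ^ 2 : ℕ) : ℝ) / X ≤ ((k : ℝ) ^ 2)⁻¹ := by
      rcases Nat.eq_zero_or_pos X with rfl | hX
      · simp
      · have hX' : (0 : ℝ) < X := by exact_mod_cast hX
        rw [div_le_iff₀ hX', mul_comm, ← div_eq_mul_inv]
        exact_mod_cast Nat.cast_div_le (α := ℝ) (m := X) (n := k ^ 2)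
    refine mul_le_mul ?_ h2 (by positivity) (abs_nonneg _)
    exact mul_le_of_le_one_left (abs_nonneg _) h1
  have e (X : ℕ) : mean X (fun n => if Squarefree n then w n else 0) = ∑' k, F X k := by
    rw [tsum_eq_sum (s := Finset.Ioc 0 X)]
    · have hcast (n : ℕ) (hn : n ∈ Finset.Ioc 0 X) : (if Squarefree n then w n else 0) =
          ∑ k ∈ Finset.Ioc 0 X, (μ k : ℝ) * if k ^ 2 ∣ n then w n else 0 := by
        have := congrArg (fun z : ℤ => (z : ℝ) * w n) (sum_moebius_sq_dvd hn)
        simp only [Int.cast_sum, Finset.sum_mul] at this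
        rw [Finset.sum_congr rfl fun k _ => show (μ k : ℝ) * (if k ^ 2 ∣ n then w n else 0) =
          ((if k ^ 2 ∣ n then μ k else 0 : ℤ) : ℝ) * w n by split_ifs <;> simp, this]
        split_ifs <;> simp
      rw [mean, Finset.sum_congr rfl hcast, Finset.sum_comm, Finset.sum_div]
      refine Finset.sum_congr rfl fun k hk => ?_
      rw [← Finset.mul_sum, sum_sq_dvd hw (Finset.mem_Ioc.1 hk).1.ne']
      simp only [hF, mean]
      rcases Nat.eq_zero_or_pos (X / k ^ 2) with h0 | h0
      · simp [h0]
      · have : ((X / k ^ 2 : ℕ) : ℝ) ≠ 0 := by exact_mod_cast h0.ne'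
        field_simp
    · intro k hk
      have : X / k ^ 2 = 0 := by
        rcases Nat.eq_zero_or_pos k with rfl | hk0
        · simp
        · refine Nat.div_eq_of_lt ?_
          have : X < k := by
            by_contra hle
            exact hk (Finset.mem_Ioc.2 ⟨hk0, not_lt.1 hle⟩)
          nlinarith
      simp [hF, this]
  simp only [e]
  rw [show (0 : ℝ) = ∑' _ : ℕ, (0 : ℝ) by simp]
  refine tendsto_tsum_of_dominated_convergence (bound := fun k : ℕ => ((k : ℝ) ^ 2)⁻¹)
    (Real.summable_nat_pow_inv.2 one_lt_two) (fun k => ?_) (Eventually.of_forall fun X k => ?_)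
  · rcases Nat.eq_zero_or_pos k with rfl | hk
    · simp [hF]
    · refine squeeze_zero_norm (hFle · k) ?_
      have := ((h.comp (Nat.tendsto_div_const_atTop (n := k ^ 2) (by positivity))).abs).mul_const
        ((k : ℝ) ^ 2)⁻¹
      simpa using this
  · exact (hFle X k).trans (mul_le_of_le_one_left (by positivity) (hmean _))

theorem one_div_four_le_mean_squarefree {X : ℕ} (hX : 0 < X) :
    1 / 4 ≤ mean X fun n => if Squarefree n then (1 : ℝ) else 0 := by
  have hX' : (X : ℝ) ≠ 0 := by exact_mod_cast hX.ne'
  have h1 : mean X (fun n => 1 - ∑ p ∈ Nat.primesLE X, if p ^ 2 ∣ n then (1 : ℝ) else 0) ≤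
      mean X fun n => if Squarefree n then (1 : ℝ) else 0 := by
    refine mean_mono fun n hn => ?_
    have hnn : 0 ≤ ∑ p ∈ Nat.primesLE X, if p ^ 2 ∣ n then (1 : ℝ) else 0 :=
      Finset.sum_nonneg fun p _ => by split_ifs <;> norm_num
    split_ifs with hsq
    · linarith
    · obtain ⟨hn0, hnX⟩ := Finset.mem_Ioc.1 hn
      rw [Nat.squarefree_iff_prime_squarefree] at hsq
      push Not at hsq
      obtain ⟨p, hp, hpn⟩ := hsq
      have hmem : p ∈ Nat.primesLE X := Nat.mem_primesLE.2
        ⟨(Nat.le_of_dvd hn0 (dvd_of_mul_left_dvd hpn)).trans hnX, hp⟩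
      have := Finset.single_le_sum (f := fun p => if p ^ 2 ∣ n then (1 : ℝ) else 0)
        (fun p _ => by split_ifs <;> norm_num) hmem
      simp only [pow_two p, hpn, if_true] at this
      linarith
  refine le_trans ?_ h1
  rw [mean_sub, mean_sum]
  have h2 : mean X (fun _ => (1 : ℝ)) = 1 := by simp [mean, hX']
  have h3 := (Finset.sum_le_sum fun p (_ : p ∈ Nat.primesLE X) =>
    mean_dvd_le X (D := p ^ 2)).trans_eq (Finset.sum_congr rfl fun p _ => by rw [Nat.cast_pow])
  have h4 := sum_inv_sq_primesLE_le X
  linarith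

theorem card_filter_range_div {Q : ℕ → Prop} [DecidablePred Q] (h0 : ¬ Q 0) (X : ℕ) :
    (((Finset.range (X + 1)).filter Q).card : ℝ) / X = mean X fun n => if Q n then 1 else 0 := by
  rw [mean, Finset.sum_boole]
  congr 3
  ext n
  simp only [Finset.mem_filter, Finset.mem_range, Finset.mem_Ioc]
  refine ⟨fun h => ⟨⟨Nat.pos_of_ne_zero ?_, by omega⟩, h.2⟩, fun h => ⟨by omega, h.2⟩⟩
  rintro rfl
  exact h0 h.2

theorem tendsto_card_squarefree_div {P : ℕ → Prop} [DecidablePred P]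
    (hP : ∀ k m, k ≠ 0 → m ≠ 0 → (P (k ^ 2 * m) ↔ P m))
    (h : Tendsto (fun N => mean N fun m => if P m then (1 : ℝ) else 0) atTop (𝓝 (1 / 2))) :
    Tendsto (fun X : ℕ =>
      (((Finset.range (X + 1)).filter fun n => Squarefree n ∧ P n).card : ℝ) /
        ((Finset.range (X + 1)).filter fun n => Squarefree n).card) atTop (𝓝 (1 / 2)) := by
  have hw := tendsto_mean_squarefree (w := fun m => (if P m then (1 : ℝ) else 0) - 1 / 2)
    (fun k m hk hm => by simp only [hP k m hk hm])
    (fun m => by split_ifs <;> norm_num [abs_le]) (by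
      have : Tendsto (fun N => (mean N fun m => if P m then (1 : ℝ) else 0) - 1 / 2) atTop
          (𝓝 (1 / 2 - 1 / 2)) := h.sub_const _
      rw [sub_self] at this
      refine this.congr' ?_
      filter_upwards [eventually_ne_atTop 0] with N hN
      rw [mean_sub]
      simp [mean, hN])
  rw [← tendsto_sub_nhds_zero_iff]
  refine squeeze_zero_norm' (a := fun X => 4 * |mean X fun n => if Squarefree n then
    (if P n then (1 : ℝ) else 0) - 1 / 2 else 0|) ?_ (by simpa using hw.abs.const_mul 4)
  filter_upwards [eventually_gt_atTop 0] with X hX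
  have hX' : (X : ℝ) ≠ 0 := by exact_mod_cast hX.ne'
  have h1 := one_div_four_le_mean_squarefree hX
  have e : mean X (fun n => if Squarefree n then (if P n then (1 : ℝ) else 0) - 1 / 2 else 0) =
      mean X (fun n => if Squarefree n ∧ P n then (1 : ℝ) else 0) -
        1 / 2 * mean X (fun n => if Squarefree n then (1 : ℝ) else 0) := by
    rw [← mean_const_mul, ← mean_sub]
    congr 1
    funext n
    by_cases hs : Squarefree n <;> simp [hs]
  rw [← div_div_div_cancel_right₀ hX', card_filter_range_div (by simp),
    card_filter_range_div (by simp), e, Real.norm_eq_abs]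
  set s := mean X (fun n => if Squarefree n then (1 : ℝ) else 0)
  set a := mean X (fun n => if Squarefree n ∧ P n then (1 : ℝ) else 0)
  have hs : 0 < s := by linarith
  rw [show a / s - 1 / 2 = (a - 1 / 2 * s) / s by field_simp, abs_div, abs_of_pos hs,
    div_le_iff₀ hs]
  nlinarith [abs_nonneg (a - 1 / 2 * s)]

theorem oddPrimeSum_sq_mul (f : ℕ → ℝ) {k m : ℕ} (hk : k ≠ 0) (hm : m ≠ 0) :
    oddPrimeSum f (k ^ 2 * m) = oddPrimeSum f m := by
  have hmem (n p : ℕ) : p ∈ n.primeFactors.filter (fun p => Odd (n.factorization p)) ↔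
      Odd (n.factorization p) := by
    rw [Finset.mem_filter, and_iff_right_iff_imp, ← Nat.support_factorization,
      Finsupp.mem_support_iff]
    exact fun h => h.pos.ne'
  rw [oddPrimeSum, oddPrimeSum]
  congr 1
  ext p
  rw [hmem, hmem, Nat.factorization_mul (by positivity) hm, Nat.factorization_pow]
  simp [Nat.odd_add']

theorem oddPrimeSum_of_squarefree (f : ℕ → ℝ) {n : ℕ} (hn : Squarefree n) :
    oddPrimeSum f n = ∑ p ∈ n.primeFactors, f p := by
  rw [oddPrimeSum, Finset.filter_true_of_mem fun p hp => ?_]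
  have h1 := hn.natFactorization_le_one p
  have h2 : n.factorization p ≠ 0 := by
    rwa [← Finsupp.mem_support_iff, Nat.support_factorization]
  rw [show n.factorization p = 1 by omega]
  exact odd_one

end LegendreAdditive

open Filter
open scoped Classical

/-- at least half of squarefree numbers have g(n) ≥ r, in the liminf sense. -/
theorem legendre_additive_liminf_half (Δ Δ' : ℤ)
    (h1 : ¬ IsSquare Δ) (h2 : ¬ IsSquare Δ') (h3 : ¬ IsSquare (Δ * Δ')) (r : ℝ) :
    (1 : ℝ) / 2 ≤ Filter.liminf (fun X : ℝ =>
      (((Finset.range (⌊X⌋₊ + 1)).filter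
          (fun n => Squarefree n ∧
            r ≤ ∑ p ∈ n.primeFactors.filter (fun p => Odd p ∧ ¬ ((p : ℤ) ∣ Δ)),
              ((jacobiSym Δ' p : ℝ) - (jacobiSym Δ p : ℝ)) / 2)).card : ℝ) /
      (((Finset.range (⌊X⌋₊ + 1)).filter (fun n => Squarefree n)).card : ℝ))
      Filter.atTop := by
  obtain ⟨C, hC⟩ := LegendreAdditive.exists_forall_abs_sum_halfDiff_div_le h1 h2
  have hhalf := LegendreAdditive.tendsto_mean_le_oddPrimeSum
    (LegendreAdditive.abs_halfDiff_le_one Δ Δ') hC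
    (LegendreAdditive.tendsto_sum_halfDiff_sq_div h1 h2 h3) r
  have hlim := (LegendreAdditive.tendsto_card_squarefree_div (P := fun n =>
    r ≤ LegendreAdditive.oddPrimeSum (LegendreAdditive.halfDiff Δ Δ') n)
    (fun k m hk hm => by rw [LegendreAdditive.oddPrimeSum_sq_mul _ hk hm])
    (by convert hhalf)).comp (tendsto_nat_floor_atTop (α := ℝ))
  refine (Tendsto.liminf_eq (hlim.congr fun X => ?_)).ge
  simp only [Function.comp_apply]
  congr 3
  · ext n
    simp only [Finset.mem_filter, and_congr_right_iff]
    intro _ hn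
    rw [LegendreAdditive.oddPrimeSum_of_squarefree _ hn, Finset.sum_filter]
    simp only [LegendreAdditive.halfDiff]
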